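/- The following are equivalent for a cardinal δ: (1) for every A ⊆ δ there is κ < δ which is <δ-strongly compact for A; (2) for every pair A₁, A₂ ⊆ δ there is κ < δ which is <δ-strongly compact for A₁ ⊕ A₂, i.e. for every λ with κ ≤ λ < δ there is a λ-strong compactness embedding j with crit(j) = κ, A₁ ∩ λ = j(A₁) ∩ λ and A₂ ∩ λ = j(A₂) ∩ λ; (3) for every A ⊆ V_δ there is κ < δ which is both <δ-strongly compact and <δ-strong for A. -/

import Mathlib

/-!
A framework for formalizing large-cardinal notions from
"Woodin for strong compactness cardinals" over the Mathlib model `ZFSet`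
of ZFC.  The ambient set-theoretic universe `V` is the type `ZFSet`;
classes are sets `Set ZFSet`; everything is relativised to a "universe
class" `W : Set ZFSet` (the ambient universe being `W = Set.univ`), so
that the same definitions can also be interpreted inside transitive set
models of ZFC (used to express the forcing/consistency results).
-/

namespace WSC

/-! ### First-order formulas in the language of set theory -/

/-- First-order formulas in the language `{∈}`, with `n` free (de Bruijn) variables. -/
inductive Fml : ℕ → Type where
  | mem {n} : Fin n → Fin n → Fml n
  | eq  {n} : Fin n → Fin n → Fml n
  | not {n} : Fml n → Fml n
  | and {n} : Fml n → Fml n → Fml n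
  | ex  {n} : Fml (n + 1) → Fml n

namespace Fml

/-- Realization of a formula over the class `C`, with all quantifiers relativised to `C`. -/
def Realize (C : Set ZFSet) : ∀ {n}, Fml n → (Fin n → ZFSet) → Prop
  | _, .mem i j, v => v i ∈ v j
  | _, .eq i j, v => v i = v j
  | _, .not φ, v => ¬ Realize C φ v
  | _, .and φ ψ, v => Realize C φ v ∧ Realize C ψ v
  | _, .ex φ, v => ∃ x ∈ C, Realize C φ (Fin.snoc v x)

def or {n} (φ ψ : Fml n) : Fml n := .not (.and (.not φ) (.not ψ))
def imp {n} (φ ψ : Fml n) : Fml n := Fml.or (.not φ) ψ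
def iff {n} (φ ψ : Fml n) : Fml n := .and (imp φ ψ) (imp ψ φ)
def all {n} (φ : Fml (n + 1)) : Fml n := .not (.ex (.not φ))

/-- Universal closure. -/
def alls : ∀ {n}, Fml n → Fml 0
  | 0, φ => φ
  | _ + 1, φ => alls (all φ)

/-- Renaming of variables. -/
def rename : ∀ {n m}, (Fin n → Fin m) → Fml n → Fml m
  | _, _, f, .mem i j => .mem (f i) (f j)
  | _, _, f, .eq i j => .eq (f i) (f j)
  | _, _, f, .not φ => .not (rename f φ)
  | _, _, f, .and φ ψ => .and (rename f φ) (rename f ψ)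
  | _, _, f, .ex φ => .ex (rename (Fin.snoc (fun i => (f i).castSucc) (Fin.last _)) φ)

end Fml

/-- A sentence `φ` holds in the class `C`. -/
def Sat (C : Set ZFSet) (φ : Fml 0) : Prop := Fml.Realize C φ (fun i => i.elim0)

/-! ### The ZFC axioms -/

def extAx : Fml 0 :=
  Fml.all (Fml.all (Fml.imp (Fml.all (Fml.iff (.mem 2 0) (.mem 2 1))) (.eq 0 1)))

def pairAx : Fml 0 := Fml.all (Fml.all (Fml.ex (Fml.and (.mem 0 2) (.mem 1 2))))

def unionAx : Fml 0 :=
  Fml.all (Fml.ex (Fml.all (Fml.all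
    (Fml.imp (Fml.and (.mem 2 3) (.mem 3 0)) (.mem 2 1)))))

def powerAx : Fml 0 :=
  Fml.all (Fml.ex (Fml.all
    (Fml.imp (Fml.all (Fml.imp (.mem 3 2) (.mem 3 0))) (.mem 2 1))))

def infAx : Fml 0 :=
  Fml.ex (Fml.and
    (Fml.ex (Fml.and (.mem 1 0) (Fml.all (Fml.not (.mem 2 1)))))
    (Fml.all (Fml.imp (.mem 1 0)
      (Fml.ex (Fml.and (.mem 2 0)
        (Fml.all (Fml.iff (.mem 3 2) (Fml.or (.mem 3 1) (.eq 3 1)))))))))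

def foundAx : Fml 0 :=
  Fml.all (Fml.imp (Fml.ex (.mem 1 0))
    (Fml.ex (Fml.and (.mem 1 0) (Fml.all (Fml.imp (.mem 2 1) (Fml.not (.mem 2 0)))))))

def choiceAx : Fml 0 :=
  Fml.all (Fml.imp
    (Fml.and
      (Fml.all (Fml.imp (.mem 1 0) (Fml.ex (.mem 2 1))))
      (Fml.all (Fml.all (Fml.imp
        (Fml.and (.mem 1 0) (Fml.and (.mem 2 0) (Fml.ex (Fml.and (.mem 3 1) (.mem 3 2)))))
        (.eq 1 2)))))
    (Fml.ex (Fml.all (Fml.imp (.mem 2 0)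
      (Fml.ex (Fml.and (Fml.and (.mem 3 2) (.mem 3 1))
        (Fml.all (Fml.imp (Fml.and (.mem 4 2) (.mem 4 1)) (.eq 4 3)))))))))

/-- An instance of the separation schema, for a formula `φ` with parameters
`0, …, n-1` and distinguished variable `n`. -/
def sepAx (n : ℕ) (φ : Fml (n + 1)) : Fml 0 :=
  Fml.alls ((Fml.ex (Fml.all (Fml.iff
    (Fml.mem (⟨n + 2, by omega⟩ : Fin (n + 3)) ⟨n + 1, by omega⟩)
    (Fml.and (Fml.mem (⟨n + 2, by omega⟩ : Fin (n + 3)) ⟨n, by omega⟩)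
      (Fml.rename (fun i => if h : (i : ℕ) < n then (⟨i, by omega⟩ : Fin (n + 3))
        else ⟨n + 2, by omega⟩) φ))))) : Fml (n + 1))

/-- An instance of the collection schema, for a formula `φ` with parameters
`0, …, n-1` and distinguished variables `n` (input) and `n+1` (output). -/
def collAx (n : ℕ) (φ : Fml (n + 2)) : Fml 0 :=
  let φ' : Fml (n + 4) := Fml.rename (fun i => if h : (i : ℕ) < n then (⟨i, by omega⟩ : Fin (n + 4))
    else ⟨(i : ℕ) + 2, by have := i.isLt; omega⟩) φ
  Fml.alls ((Fml.ex (Fml.all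
    (Fml.imp (Fml.mem (⟨n + 2, by omega⟩ : Fin (n + 3)) ⟨n, by omega⟩)
      (Fml.imp (Fml.ex φ')
        (Fml.ex (Fml.and (Fml.mem (⟨n + 3, by omega⟩ : Fin (n + 4)) ⟨n + 1, by omega⟩) φ')))))) : Fml (n + 1))

/-- The ZFC axioms. -/
def ZFCax : Set (Fml 0) :=
  {extAx, pairAx, unionAx, powerAx, infAx, foundAx, choiceAx} ∪
    (⋃ n, Set.range (sepAx n)) ∪ (⋃ n, Set.range (collAx n))

/-- A transitive set model of ZFC. -/
def IsZFModel (m : ZFSet) : Prop := m.IsTransitive ∧ ∀ φ ∈ ZFCax, Sat m.toSet φ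

/-- A countable transitive model of ZFC. -/
def IsCtm (m : ZFSet) : Prop := IsZFModel m ∧ m.toSet.Countable

/-! ### Basic set-theoretic notions -/

/-- `x` is a (von Neumann) ordinal: a transitive set of transitive sets. -/
def IsOrd (x : ZFSet) : Prop := x.IsTransitive ∧ ∀ y ∈ x, ZFSet.IsTransitive y

/-- `x ≤ y` for ordinals. -/
def oLe (x y : ZFSet) : Prop := x ∈ y ∨ x = y

/-- `f` is a function with domain `d` (coded as a set of Kuratowski pairs). -/
def IsFuncOn (d f : ZFSet) : Prop :=
  (∀ p ∈ f, ∃ a b : ZFSet, a ∈ d ∧ p = a.pair b) ∧ ∀ a ∈ d, ∃! b : ZFSet, a.pair b ∈ f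

/-- All values of the (partial) function `f` lie in `b`. -/
def MapsInto (f b : ZFSet) : Prop := ∀ x y : ZFSet, x.pair y ∈ f → y ∈ b

/-- The function `f` is injective. -/
def InjFun (f : ZFSet) : Prop := ∀ x x' y : ZFSet, x.pair y ∈ f → x'.pair y ∈ f → x = x'

/-- `|a| ≤ |b|`, witnessed by an injection belonging to the universe class `W`. -/
def SetLeIn (W : Set ZFSet) (a b : ZFSet) : Prop :=
  ∃ f ∈ W, IsFuncOn a f ∧ MapsInto f b ∧ InjFun f

/-- `κ` is a cardinal (relative to the universe class `W`). -/
def IsCardIn (W : Set ZFSet) (κ : ZFSet) : Prop :=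
  IsOrd κ ∧ ∀ α ∈ κ, ¬ SetLeIn W κ α

/-- `M` is a transitive class. -/
def TransClass (M : Set ZFSet) : Prop := ∀ x ∈ M, ∀ y : ZFSet, y ∈ x → y ∈ M

/-- An elementary embedding `j : (W, ∈) → (M, ∈)` between two classes. -/
structure ElemEmb (W M : Set ZFSet) where
  toFun : ZFSet → ZFSet
  maps : ∀ x ∈ W, toFun x ∈ M
  elem : ∀ {n : ℕ} (φ : Fml n) (v : Fin n → ZFSet), (∀ i, v i ∈ W) →
    (Fml.Realize W φ v ↔ Fml.Realize M φ (fun i => toFun (v i)))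

/-- `κ` is the critical point of `j`: the least ordinal moved. -/
def IsCrit {W M : Set ZFSet} (j : ElemEmb W M) (κ : ZFSet) : Prop :=
  IsOrd κ ∧ j.toFun κ ≠ κ ∧ ∀ α ∈ κ, j.toFun α = α

/-! ### The rank hierarchy -/

/-- `x ∈ V_lam`. -/
def VMem (lam x : ZFSet) : Prop := x.rank < lam.rank

/-- `V_lam ⊆ M` (with `V_lam` computed in the universe class `W`). -/
def VInclIn (W M : Set ZFSet) (lam : ZFSet) : Prop := ∀ x ∈ W, VMem lam x → x ∈ M

/-- `A ⊆ V_δ`. -/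
def SubV (A δ : ZFSet) : Prop := ∀ x ∈ A, VMem δ x

/-- `A ∩ V_lam = B ∩ V_lam`. -/
def AgreeBelowIn (W : Set ZFSet) (lam A B : ZFSet) : Prop :=
  ∀ x ∈ W, VMem lam x → (x ∈ A ↔ x ∈ B)

/-- `A ∩ lam = B ∩ lam` (for sets of ordinals). -/
def AgreeMem (lam A B : ZFSet) : Prop := ∀ ξ ∈ lam, (ξ ∈ A ↔ ξ ∈ B)

/-! ### Covering properties -/

/-- `M ⊨ |s| < t`: in `M` there is an injection of `s` into some ordinal `β ∈ t`. -/
def CardLtIn (M : Set ZFSet) (s t : ZFSet) : Prop :=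
  ∃ β f : ZFSet, β ∈ t ∧ f ∈ M ∧ IsFuncOn s f ∧ MapsInto f β ∧ InjFun f

/-- `j` satisfies the weak `lam`-covering property (with target class `M`):
there is `s ∈ M` with `j '' lam ⊆ s` and `M ⊨ |s| < j κ`. -/
def WCovers (M : Set ZFSet) (j : ZFSet → ZFSet) (κ lam : ZFSet) : Prop :=
  ∃ s ∈ M, (∀ α ∈ lam, j α ∈ s) ∧ CardLtIn M s (j κ)

/-- `j` satisfies the (full) `lam`-covering property: every `X ∈ W` with
`X ⊆ M` and `|X| ≤ lam` is covered by some `s ∈ M` with `M ⊨ |s| < j κ`. -/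
def CoversIn (W M : Set ZFSet) (j : ZFSet → ZFSet) (κ lam : ZFSet) : Prop :=
  ∀ X ∈ W, X.toSet ⊆ M → SetLeIn W X lam → ∃ s ∈ M, X ⊆ s ∧ CardLtIn M s (j κ)

/-! ### Strongness -/

/-- `κ` is `lam`-strong. -/
def LamStrongIn (W : Set ZFSet) (κ lam : ZFSet) : Prop :=
  ∃ M : Set ZFSet, M ⊆ W ∧ TransClass M ∧ ∃ j : ElemEmb W M,
    IsCrit j κ ∧ lam ∈ j.toFun κ ∧ VInclIn W M lam

/-- `κ` is `lam`-strong for `A`. -/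
def LamStrongForIn (W : Set ZFSet) (κ lam A : ZFSet) : Prop :=
  ∃ M : Set ZFSet, M ⊆ W ∧ TransClass M ∧ ∃ j : ElemEmb W M,
    IsCrit j κ ∧ lam ∈ j.toFun κ ∧ VInclIn W M lam ∧ AgreeBelowIn W lam A (j.toFun A)

/-- `κ` is `<δ`-strong. -/
def LtStrongIn (W : Set ZFSet) (κ δ : ZFSet) : Prop :=
  ∀ lam : ZFSet, oLe κ lam → lam ∈ δ → LamStrongIn W κ lam

/-- `κ` is `<δ`-strong for `A`. -/
def LtStrongForIn (W : Set ZFSet) (κ δ A : ZFSet) : Prop :=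
  ∀ lam : ZFSet, oLe κ lam → lam ∈ δ → LamStrongForIn W κ lam A

/-! ### Strong compactness -/

/-- `κ` is `lam`-strongly compact (there is an embedding with critical point `κ`,
`j κ > lam`, satisfying the weak `lam`-covering property). -/
def LamSCIn (W : Set ZFSet) (κ lam : ZFSet) : Prop :=
  ∃ M : Set ZFSet, M ⊆ W ∧ TransClass M ∧ ∃ j : ElemEmb W M,
    IsCrit j κ ∧ lam ∈ j.toFun κ ∧ WCovers M j.toFun κ lam

/-- `κ` is `lam`-strongly compact for the set of ordinals `A`: there is a
`lam`-strong compactness embedding `j` (one with the full `lam`-covering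
property) with critical point `κ` and `A ∩ lam = j A ∩ lam`. -/
def LamSCForIn (W : Set ZFSet) (κ lam A : ZFSet) : Prop :=
  ∃ M : Set ZFSet, M ⊆ W ∧ TransClass M ∧ ∃ j : ElemEmb W M,
    IsCrit j κ ∧ lam ∈ j.toFun κ ∧ CoversIn W M j.toFun κ lam ∧ AgreeMem lam A (j.toFun A)

/-- `κ` is `<δ`-strongly compact. -/
def LtSCIn (W : Set ZFSet) (κ δ : ZFSet) : Prop :=
  ∀ lam : ZFSet, oLe κ lam → lam ∈ δ → LamSCIn W κ lam

/-- `κ` is `<δ`-strongly compact for `A`. -/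
def LtSCForIn (W : Set ZFSet) (κ δ A : ZFSet) : Prop :=
  ∀ lam : ZFSet, oLe κ lam → lam ∈ δ → LamSCForIn W κ lam A

/-! ### Supercompactness -/

/-- `M` is closed under `lam`-sequences (from the universe class `W`). -/
def SeqClosedIn (W M : Set ZFSet) (lam : ZFSet) : Prop :=
  ∀ f ∈ W, IsFuncOn lam f → (∀ x y : ZFSet, x.pair y ∈ f → y ∈ M) → f ∈ M

/-- `κ` is `lam`-supercompact. -/
def LamSupercompactIn (W : Set ZFSet) (κ lam : ZFSet) : Prop :=
  ∃ M : Set ZFSet, M ⊆ W ∧ TransClass M ∧ ∃ j : ElemEmb W M,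
    IsCrit j κ ∧ lam ∈ j.toFun κ ∧ SeqClosedIn W M lam

/-- `κ` is `lam`-supercompact for `A`. -/
def LamSupercompactForIn (W : Set ZFSet) (κ lam A : ZFSet) : Prop :=
  ∃ M : Set ZFSet, M ⊆ W ∧ TransClass M ∧ ∃ j : ElemEmb W M,
    IsCrit j κ ∧ lam ∈ j.toFun κ ∧ SeqClosedIn W M lam ∧ AgreeBelowIn W lam A (j.toFun A)

/-- `κ` is `<δ`-supercompact. -/
def LtSupercompactIn (W : Set ZFSet) (κ δ : ZFSet) : Prop :=
  ∀ lam : ZFSet, oLe κ lam → lam ∈ δ → LamSupercompactIn W κ lam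

/-- `κ` is `<δ`-supercompact for `A`. -/
def LtSupercompactForIn (W : Set ZFSet) (κ δ A : ZFSet) : Prop :=
  ∀ lam : ZFSet, oLe κ lam → lam ∈ δ → LamSupercompactForIn W κ lam A

/-! ### The global large-cardinal notions -/

/-- `δ` is a Woodin cardinal. -/
def WoodinIn (W : Set ZFSet) (δ : ZFSet) : Prop :=
  IsCardIn W δ ∧ ∀ A ∈ W, SubV A δ → ∃ κ, κ ∈ δ ∧ LtStrongForIn W κ δ A

/-- `δ` is a Woodin for strong compactness cardinal. -/
def WoodinSCIn (W : Set ZFSet) (δ : ZFSet) : Prop :=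
  IsCardIn W δ ∧ ∀ A ∈ W, A ⊆ δ → ∃ κ, κ ∈ δ ∧ LtSCForIn W κ δ A

/-- `δ` is a Vopěnka cardinal. -/
def VopenkaIn (W : Set ZFSet) (δ : ZFSet) : Prop :=
  IsCardIn W δ ∧ ∀ A ∈ W, SubV A δ → ∃ κ, κ ∈ δ ∧ LtSupercompactForIn W κ δ A

/-- `δ` is Woodin and a limit of `<δ`-supercompact cardinals. -/
def WoodinLimSupercompactIn (W : Set ZFSet) (δ : ZFSet) : Prop :=
  WoodinIn W δ ∧ ∀ α ∈ δ, ∃ κ : ZFSet, α ∈ κ ∧ κ ∈ δ ∧ LtSupercompactIn W κ δ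

/-! ### Inaccessibility -/

/-- `δ` is a regular ordinal: the range of any function from a smaller
ordinal into `δ` is bounded. -/
def RegularIn (W : Set ZFSet) (δ : ZFSet) : Prop :=
  IsOrd δ ∧ ∀ α ∈ δ, ∀ f ∈ W, IsFuncOn α f → MapsInto f δ →
    ∃ β ∈ δ, ∀ x y : ZFSet, x.pair y ∈ f → y ∈ β

/-- The power set of `x` relative to `W`. -/
def powersetIn (W : Set ZFSet) (x : ZFSet) : ZFSet := ZFSet.sep (fun z => z ∈ W) x.powerset

/-- `δ` is a strong limit cardinal. -/
def StrongLimitIn (W : Set ZFSet) (δ : ZFSet) : Prop :=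
  IsCardIn W δ ∧ ∀ α ∈ δ, ∃ β ∈ δ, SetLeIn W (powersetIn W α) β

/-- `δ` is inaccessible: an uncountable regular strong limit cardinal. -/
def InaccessibleIn (W : Set ZFSet) (δ : ZFSet) : Prop :=
  ZFSet.omega ∈ δ ∧ IsCardIn W δ ∧ RegularIn W δ ∧ StrongLimitIn W δ

/-! ### Ultrafilters and measurability -/

/-- Relative complement `a \ b`. -/
def zdiff (a b : ZFSet) : ZFSet := ZFSet.sep (fun x => x ∉ b) a

/-- Intersection `a ∩ b`. -/
def zinter (a b : ZFSet) : ZFSet := ZFSet.sep (fun x => x ∈ b) a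

/-- `U` is a nonprincipal `α`-complete ultrafilter on `α`. -/
def IsUfOnIn (W : Set ZFSet) (α U : ZFSet) : Prop :=
  (∀ x ∈ U, x ⊆ α) ∧ α ∈ U ∧ (∅ : ZFSet) ∉ U ∧
  (∀ x ∈ U, ∀ y : ZFSet, y ∈ W → y ⊆ α → x ⊆ y → y ∈ U) ∧
  (∀ x ∈ W, x ⊆ α → (x ∈ U ∨ zdiff α x ∈ U)) ∧
  (∀ β ∈ α, ∀ g ∈ W, IsFuncOn β g → MapsInto g U →
    ZFSet.sep (fun ξ => ∀ p q : ZFSet, p.pair q ∈ g → ξ ∈ q) α ∈ U) ∧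
  (∀ ξ ∈ α, ZFSet.sep (fun x => x = ξ) α ∉ U)

/-- `U` is a normal ultrafilter on `α`: a nonprincipal `α`-complete
ultrafilter closed under diagonal intersections. -/
def IsNormalUfOnIn (W : Set ZFSet) (α U : ZFSet) : Prop :=
  IsUfOnIn W α U ∧
    ∀ g ∈ W, IsFuncOn α g → MapsInto g U →
      ZFSet.sep (fun ξ => ∀ p q : ZFSet, p.pair q ∈ g → p ∈ ξ → ξ ∈ q) α ∈ U

/-- `α` is a measurable cardinal. -/
def MeasurableIn (W : Set ZFSet) (α : ZFSet) : Prop := ∃ U ∈ W, IsUfOnIn W α U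

/-! ### Functions `f : δ → δ` and closure points -/

/-- `f` codes a function from `δ` to `δ`. -/
def FuncSelf (δ f : ZFSet) : Prop := IsFuncOn δ f ∧ MapsInto f δ

/-- `κ` is a closure point of `f`, i.e. `f '' κ ⊆ κ`. -/
def ClosurePt (f κ : ZFSet) : Prop := ∀ x y : ZFSet, x.pair y ∈ f → x ∈ κ → y ∈ κ

/-! ### GCH -/

/-- GCH: for every infinite cardinal `κ`, any family of subsets of `κ` has
size at most `κ` or size at least that of the full power set of `κ`. -/
def GCHIn (W : Set ZFSet) : Prop :=
  ∀ κ ∈ W, IsCardIn W κ → oLe ZFSet.omega κ →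
    ∀ X ∈ W, (∀ z ∈ X, z ⊆ κ) → (SetLeIn W X κ ∨ SetLeIn W (powersetIn W κ) X)

/-! ### Forcing -/

/-- `(P, R)` is a forcing notion (a preordered set, `x.pair y ∈ R` meaning
`x ≤ y`, i.e. `x` is stronger than `y`). -/
def IsPoset (P R : ZFSet) : Prop :=
  (∀ p ∈ P, p.pair p ∈ R) ∧
  (∀ p q r : ZFSet, p.pair q ∈ R → q.pair r ∈ R → p.pair r ∈ R) ∧
  (∀ x y : ZFSet, x.pair y ∈ R → x ∈ P ∧ y ∈ P)

/-- `G` is an `m`-generic filter on the forcing notion `(P, R) ∈ m`. -/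
def IsGenericFilter (m P R G : ZFSet) : Prop :=
  G ⊆ P ∧
  (∀ p ∈ G, ∀ q ∈ P, p.pair q ∈ R → q ∈ G) ∧
  (∀ p ∈ G, ∀ q ∈ G, ∃ r ∈ G, r.pair p ∈ R ∧ r.pair q ∈ R) ∧
  (∀ D ∈ m, (D ⊆ P ∧ ∀ p ∈ P, ∃ q ∈ D, q.pair p ∈ R) → ∃ q, q ∈ G ∧ q ∈ D)

/-- `n = m[G]` : `n` is a transitive ZFC-model extending `m` and containing
`G`, and is the least such. -/
def IsGenericExt (m G n : ZFSet) : Prop :=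
  IsZFModel n ∧ m ⊆ n ∧ G ∈ n ∧
    ∀ n' : ZFSet, IsZFModel n' → m ⊆ n' → G ∈ n' → n ⊆ n'

/-- `n` is a (set-)forcing extension of the transitive model `m`. -/
def IsForcingExt (m n : ZFSet) : Prop :=
  ∃ P R G : ZFSet, P ∈ m ∧ R ∈ m ∧ IsPoset P R ∧
    IsGenericFilter m P R G ∧ IsGenericExt m G n

/-! ### Ambient (full-universe) abbreviations -/

abbrev LamStrong (κ lam : ZFSet) : Prop := LamStrongIn Set.univ κ lam
abbrev LamStrongFor (κ lam A : ZFSet) : Prop := LamStrongForIn Set.univ κ lam A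
abbrev LtStrong (κ δ : ZFSet) : Prop := LtStrongIn Set.univ κ δ
abbrev LtStrongFor (κ δ A : ZFSet) : Prop := LtStrongForIn Set.univ κ δ A
abbrev LamSC (κ lam : ZFSet) : Prop := LamSCIn Set.univ κ lam
abbrev LamSCFor (κ lam A : ZFSet) : Prop := LamSCForIn Set.univ κ lam A
abbrev LtSC (κ δ : ZFSet) : Prop := LtSCIn Set.univ κ δ
abbrev LtSCFor (κ δ A : ZFSet) : Prop := LtSCForIn Set.univ κ δ A
abbrev LamSupercompact (κ lam : ZFSet) : Prop := LamSupercompactIn Set.univ κ lam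
abbrev LtSupercompact (κ δ : ZFSet) : Prop := LtSupercompactIn Set.univ κ δ
abbrev Woodin (δ : ZFSet) : Prop := WoodinIn Set.univ δ
abbrev WoodinSC (δ : ZFSet) : Prop := WoodinSCIn Set.univ δ
abbrev Vopenka (δ : ZFSet) : Prop := VopenkaIn Set.univ δ
abbrev IsCard (κ : ZFSet) : Prop := IsCardIn Set.univ κ
abbrev Inaccessible (δ : ZFSet) : Prop := InaccessibleIn Set.univ δ
abbrev Covers (M : Set ZFSet) (j : ZFSet → ZFSet) (κ lam : ZFSet) : Prop :=
  CoversIn Set.univ M j κ lam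
abbrev VIncl (M : Set ZFSet) (lam : ZFSet) : Prop := VInclIn Set.univ M lam
abbrev AgreeBelow (lam A B : ZFSet) : Prop := AgreeBelowIn Set.univ lam A B
abbrev SeqClosed (M : Set ZFSet) (lam : ZFSet) : Prop := SeqClosedIn Set.univ M lam

/-- `κ` is `lam`-strongly compact for `A₁ ⊕ A₂`. -/
def LamSCFor2 (κ lam A₁ A₂ : ZFSet) : Prop :=
  ∃ M : Set ZFSet, TransClass M ∧ ∃ j : ElemEmb Set.univ M,
    IsCrit j κ ∧ lam ∈ j.toFun κ ∧ Covers M j.toFun κ lam ∧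
      AgreeMem lam A₁ (j.toFun A₁) ∧ AgreeMem lam A₂ (j.toFun A₂)

/-- `κ` is `<δ`-strongly compact for `A₁ ⊕ A₂`. -/
def LtSCFor2 (κ δ A₁ A₂ : ZFSet) : Prop :=
  ∀ lam : ZFSet, oLe κ lam → lam ∈ δ → LamSCFor2 κ lam A₁ A₂

section Helpers
open Set
universe u

theorem Fml.realize_rename (C : Set ZFSet.{u}) {n : ℕ} (φ : Fml n) :
    ∀ {m : ℕ} (f : Fin n → Fin m) (v : Fin m → ZFSet.{u}),
      (φ.rename f).Realize C v ↔ φ.Realize C (fun i => v (f i)) := by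
  induction φ with
  | mem i j => intro m f v; rfl
  | eq i j => intro m f v; rfl
  | not φ ih => intro m f v; exact not_congr (ih f v)
  | and φ ψ ih ih' => intro m f v; exact and_congr (ih f v) (ih' f v)
  | ex φ ih =>
    intro m f v
    simp only [Fml.rename, Fml.Realize]
    refine exists_congr fun x => and_congr_right fun _ => ?_
    rw [ih]
    refine iff_of_eq (congrArg _ (funext fun i => ?_))
    refine Fin.lastCases ?_ (fun i => ?_) i <;> simp

/-- `Q` is a first-order property, uniformly over all transitive classes. -/
class Dfn {ι : Type} (Q : Set ZFSet.{u} → (ι → ZFSet.{u}) → Prop) : Prop where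
  out : ∃ (n : ℕ) (f : Fin n → ι) (φ : Fml n), ∀ C, TransClass C → ∀ v : ι → ZFSet.{u},
    (∀ i, v i ∈ C) → (φ.Realize C (fun k => v (f k)) ↔ Q C v)

namespace Dfn

variable {ι : Type} {P Q : Set ZFSet.{u} → (ι → ZFSet.{u}) → Prop}

theorem congr (h : Dfn P) (hPQ : ∀ C, TransClass C → ∀ v : ι → ZFSet.{u}, (∀ i, v i ∈ C) →
    (P C v ↔ Q C v)) : Dfn Q := by
  obtain ⟨n, f, φ, hφ⟩ := h.out
  exact ⟨n, f, φ, fun C hC v hv => (hφ C hC v hv).trans (hPQ C hC v hv)⟩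

instance mem (i j : ι) : Dfn (fun (_ : Set ZFSet.{u}) v => v i ∈ v j) :=
  ⟨2, ![i, j], .mem 0 1, fun _ _ _ _ => Iff.rfl⟩

instance eq (i j : ι) : Dfn (fun (_ : Set ZFSet.{u}) v => v i = v j) :=
  ⟨2, ![i, j], .eq 0 1, fun _ _ _ _ => Iff.rfl⟩

instance not [h : Dfn P] : Dfn (fun C v => ¬ P C v) := by
  obtain ⟨n, f, φ, hφ⟩ := h.out
  exact ⟨n, f, .not φ, fun C hC v hv => not_congr (hφ C hC v hv)⟩

instance and [hP : Dfn P] [hQ : Dfn Q] : Dfn (fun C v => P C v ∧ Q C v) := by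
  obtain ⟨n, f, φ, hφ⟩ := hP.out
  obtain ⟨m, g, ψ, hψ⟩ := hQ.out
  refine ⟨n + m, Fin.append f g,
    .and (φ.rename (Fin.castAdd m)) (ψ.rename (Fin.natAdd n)), fun C hC v hv => ?_⟩
  refine and_congr ?_ ?_
  · rw [Fml.realize_rename]
    simpa using hφ C hC v hv
  · rw [Fml.realize_rename]
    simpa using hψ C hC v hv

instance or [Dfn P] [Dfn Q] : Dfn (fun C v => P C v ∨ Q C v) :=
  congr (P := fun C v => ¬ (¬ P C v ∧ ¬ Q C v)) inferInstance fun _ _ _ _ => by tauto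

instance imp [Dfn P] [Dfn Q] : Dfn (fun C v => P C v → Q C v) :=
  congr (P := fun C v => ¬ P C v ∨ Q C v) inferInstance fun _ _ _ _ => by tauto

instance iff [Dfn P] [Dfn Q] : Dfn (fun C v => P C v ↔ Q C v) :=
  congr (P := fun C v => (P C v → Q C v) ∧ (Q C v → P C v)) inferInstance
    fun _ _ _ _ => by tauto

variable {R : Set ZFSet.{u} → (ι → ZFSet.{u}) → ZFSet.{u} → Prop}

instance ex [h : Dfn (fun C (w : Option ι → ZFSet.{u}) => R C (fun i => w (some i)) (w none))] :
    Dfn (fun C v => ∃ x ∈ C, R C v x) := by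
  obtain ⟨n, f, φ, hφ⟩ := h.out
  let S := {k : Fin n // (f k).isSome}
  let e : S ≃ Fin (Fintype.card S) := Fintype.equivFin S
  refine ⟨Fintype.card S, fun k => (f (e.symm k).1).get (e.symm k).2,
    .ex (φ.rename fun k => if hk : (f k).isSome then (e ⟨k, hk⟩).castSucc else Fin.last _),
    fun C hC v hv => ?_⟩
  refine exists_congr fun x => and_congr_right fun hx => ?_
  rw [Fml.realize_rename]
  refine Iff.trans ?_
    (hφ C hC (fun o => o.elim x v) (by rintro (_ | i); exacts [hx, hv i]))
  refine iff_of_eq (congrArg _ (funext fun k => ?_))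
  by_cases hk : (f k).isSome
  · obtain ⟨i, hi⟩ := Option.isSome_iff_exists.1 hk
    simp [hi]
  · have hk' : f k = none := by simpa using hk
    simp [hk']

instance all [Dfn (fun C (w : Option ι → ZFSet.{u}) => R C (fun i => w (some i)) (w none))] :
    Dfn (fun C v => ∀ x ∈ C, R C v x) :=
  congr (P := fun C v => ¬ ∃ x ∈ C, ¬ R C v x) (not (h := ex (R := fun C v x => ¬ R C v x)))
    fun _ _ _ _ => by push Not; rfl

instance bex (i : ι)
    [Dfn (fun C (w : Option ι → ZFSet.{u}) => R C (fun i => w (some i)) (w none))] :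
    Dfn (fun C v => ∃ x ∈ v i, R C v x) :=
  congr (P := fun C v => ∃ x ∈ C, x ∈ v i ∧ R C v x)
    (ex (R := fun C v x => x ∈ v i ∧ R C v x))
    fun _ hC _ hv => ⟨fun ⟨x, _, h⟩ => ⟨x, h⟩, fun ⟨x, h⟩ => ⟨x, hC _ (hv i) _ h.1, h⟩⟩

instance ball (i : ι)
    [Dfn (fun C (w : Option ι → ZFSet.{u}) => R C (fun i => w (some i)) (w none))] :
    Dfn (fun C v => ∀ x ∈ v i, R C v x) :=
  congr (P := fun C v => ∀ x ∈ C, x ∈ v i → R C v x)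
    (all (R := fun C v x => x ∈ v i → R C v x))
    fun _ hC _ hv => ⟨fun h x hx => h x (hC _ (hv i) _ hx) hx, fun h x _ hx => h x hx⟩

end Dfn

theorem TransClass.of_pair_mem {C : Set ZFSet.{u}} (hC : TransClass C) {a b : ZFSet.{u}}
    (h : a.pair b ∈ C) : a ∈ C ∧ b ∈ C := by
  have h2 : ({a, b} : ZFSet) ∈ C := hC _ h _ (by simp [ZFSet.pair])
  exact ⟨hC _ h2 _ (by simp), hC _ h2 _ (by simp)⟩

namespace Dfn
variable {ι : Type}

instance eq_upair (i j k : ι) :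
    Dfn (fun (_ : Set ZFSet.{u}) v => v k = ({v i, v j} : ZFSet.{u})) :=
  congr (P := fun _ v => (v i ∈ v k ∧ v j ∈ v k) ∧ ∀ x ∈ v k, x = v i ∨ x = v j) inferInstance
    fun _ _ _ _ => by
      constructor
      · rintro ⟨⟨h1, h2⟩, h3⟩
        ext z
        simp only [ZFSet.mem_pair]
        exact ⟨h3 z, by rintro (rfl | rfl) <;> assumption⟩
      · intro h
        rw [h]
        simp

instance eq_pair (i j k : ι) :
    Dfn (fun (_ : Set ZFSet.{u}) v => v k = (v i).pair (v j)) :=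
  congr (P := fun _ v => (∃ x ∈ v k, x = ({v i, v i} : ZFSet.{u})) ∧
    (∃ x ∈ v k, x = ({v i, v j} : ZFSet.{u})) ∧
    ∀ x ∈ v k, x = ({v i, v i} : ZFSet.{u}) ∨ x = ({v i, v j} : ZFSet.{u})) inferInstance
    fun _ _ _ _ => by
      constructor
      · rintro ⟨⟨_, h1, rfl⟩, ⟨_, h2, rfl⟩, h3⟩
        ext z
        simp only [ZFSet.pair, ZFSet.mem_pair]
        rw [ZFSet.pair_eq_singleton] at *
        exact ⟨h3 z, by rintro (rfl | rfl) <;> assumption⟩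
      · intro h
        rw [h]
        simp [ZFSet.pair, ZFSet.pair_eq_singleton]

instance pair_mem (i j k : ι) :
    Dfn (fun (_ : Set ZFSet.{u}) v => (v i).pair (v j) ∈ v k) :=
  congr (P := fun _ v => ∃ x ∈ v k, x = (v i).pair (v j)) inferInstance
    fun _ _ _ _ => by simp

instance triple_mem (i j k l : ι) :
    Dfn (fun (_ : Set ZFSet.{u}) v => (v i).pair ((v j).pair (v k)) ∈ v l) :=
  congr (P := fun C v => ∃ x ∈ C, x = (v j).pair (v k) ∧ (v i).pair x ∈ v l) inferInstance
    fun C hC v hv => ⟨by rintro ⟨_, _, rfl, h⟩; exact h,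
      fun h => ⟨_, (hC.of_pair_mem (hC _ (hv l) _ h)).2, rfl, h⟩⟩

instance isFuncOn (i j : ι) : Dfn (fun (_ : Set ZFSet.{u}) v => IsFuncOn (v i) (v j)) :=
  congr (P := fun C v => (∀ p ∈ v j, ∃ a ∈ v i, ∃ b ∈ C, p = a.pair b) ∧
      ∀ a ∈ v i, ∃ b ∈ C, a.pair b ∈ v j ∧ ∀ c ∈ C, a.pair c ∈ v j → c = b) inferInstance
    fun C hC v hv => by
      refine and_congr ⟨fun h p hp => ?_, fun h p hp => ?_⟩ ⟨fun h a ha => ?_, fun h a ha => ?_⟩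
      · obtain ⟨a, ha, b, _, h⟩ := h p hp
        exact ⟨a, b, ha, h⟩
      · obtain ⟨a, b, ha, rfl⟩ := h p hp
        exact ⟨a, ha, b, (hC.of_pair_mem (hC _ (hv j) _ hp)).2, rfl⟩
      · obtain ⟨b, _, hb, h⟩ := h a ha
        exact ⟨b, hb, fun c hc => h c (hC.of_pair_mem (hC _ (hv j) _ hc)).2 hc⟩
      · obtain ⟨b, hb, h⟩ := h a ha
        exact ⟨b, (hC.of_pair_mem (hC _ (hv j) _ hb)).2, hb, fun c _ => h c⟩

instance mapsInto (i j : ι) : Dfn (fun (_ : Set ZFSet.{u}) v => MapsInto (v i) (v j)) :=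
  congr (P := fun C v => ∀ x ∈ C, ∀ y ∈ C, x.pair y ∈ v i → y ∈ v j) inferInstance
    fun _ hC _ hv => ⟨fun h x y hxy =>
      have := hC.of_pair_mem (hC _ (hv i) _ hxy)
      h x this.1 y this.2 hxy, fun h x _ y _ => h x y⟩

instance injFun (i : ι) : Dfn (fun (_ : Set ZFSet.{u}) v => InjFun (v i)) :=
  congr (P := fun C v => ∀ x ∈ C, ∀ x' ∈ C, ∀ y ∈ C, x.pair y ∈ v i → x'.pair y ∈ v i → x = x')
    inferInstance
    fun _ hC _ hv => ⟨fun h x x' y hxy hxy' =>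
      have := hC.of_pair_mem (hC _ (hv i) _ hxy)
      have h' := hC.of_pair_mem (hC _ (hv i) _ hxy')
      h x this.1 x' h'.1 y this.2 hxy hxy', fun h x _ x' _ y _ => h x x' y⟩

instance cardLtIn (i j : ι) : Dfn (fun (C : Set ZFSet.{u}) v => CardLtIn C (v i) (v j)) :=
  congr (P := fun C v => ∃ β ∈ v j, ∃ f ∈ C, IsFuncOn (v i) f ∧ MapsInto f β ∧ InjFun f)
    inferInstance
    fun _ _ _ _ => ⟨fun ⟨β, hβ, f, h⟩ => ⟨β, f, hβ, h⟩, fun ⟨β, f, hβ, h⟩ => ⟨β, hβ, f, h⟩⟩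

end Dfn

namespace ElemEmb

theorem transfer {W M : Set ZFSet.{u}} (j : ElemEmb W M) (hW : TransClass W) (hM : TransClass M)
    {ι : Type} (Q : Set ZFSet.{u} → (ι → ZFSet.{u}) → Prop) [h : Dfn Q]
    (v : ι → ZFSet.{u}) (hv : ∀ i, v i ∈ W) : Q W v ↔ Q M (fun i => j.toFun (v i)) := by
  obtain ⟨n, f, φ, hφ⟩ := h.out
  rw [← hφ W hW v hv, ← hφ M hM _ fun i => j.maps _ (hv i)]
  exact j.elem φ _ fun i => hv _

theorem transfer_two {W M : Set ZFSet.{u}} (j : ElemEmb W M) (hW : TransClass W)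
    (hM : TransClass M) (Q : Set ZFSet.{u} → ZFSet.{u} → ZFSet.{u} → Prop)
    [Dfn (fun C (v : Fin 2 → ZFSet.{u}) => Q C (v 0) (v 1))] {a b : ZFSet.{u}}
    (ha : a ∈ W) (hb : b ∈ W) : Q W a b ↔ Q M (j.toFun a) (j.toFun b) :=
  j.transfer hW hM (fun C (v : Fin 2 → ZFSet.{u}) => Q C (v 0) (v 1)) ![a, b]
    (by simp [ha, hb])

theorem _root_.WSC.transClass_univ : TransClass (Set.univ : Set ZFSet.{u}) :=
  fun _ _ _ _ => Set.mem_univ _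

theorem transfer₁ {M : Set ZFSet.{u}} (j : ElemEmb (Set.univ : Set ZFSet.{u}) M) (hM : TransClass M)
    (Q : Set ZFSet.{u} → ZFSet.{u} → Prop)
    [Dfn (fun C (v : Fin 1 → ZFSet.{u}) => Q C (v 0))]
    (a : ZFSet.{u}) : Q Set.univ a ↔ Q M (j.toFun a) :=
  j.transfer transClass_univ hM (fun C (v : Fin 1 → ZFSet.{u}) => Q C (v 0))
    ![a] fun _ => Set.mem_univ _

theorem transfer₂ {M : Set ZFSet.{u}} (j : ElemEmb (Set.univ : Set ZFSet.{u}) M) (hM : TransClass M)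
    (Q : Set ZFSet.{u} → ZFSet.{u} → ZFSet.{u} → Prop)
    [Dfn (fun C (v : Fin 2 → ZFSet.{u}) => Q C (v 0) (v 1))]
    (a b : ZFSet.{u}) : Q Set.univ a b ↔ Q M (j.toFun a) (j.toFun b) :=
  j.transfer transClass_univ hM (fun C (v : Fin 2 → ZFSet.{u}) => Q C (v 0) (v 1))
    ![a, b] fun _ => Set.mem_univ _

theorem transfer₃ {M : Set ZFSet.{u}} (j : ElemEmb (Set.univ : Set ZFSet.{u}) M) (hM : TransClass M)
    (Q : Set ZFSet.{u} → ZFSet.{u} → ZFSet.{u} → ZFSet.{u} → Prop)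
    [Dfn (fun C (v : Fin 3 → ZFSet.{u}) => Q C (v 0) (v 1) (v 2))]
    (a b c : ZFSet.{u}) : Q Set.univ a b c ↔ Q M (j.toFun a) (j.toFun b) (j.toFun c) :=
  j.transfer transClass_univ hM (fun C (v : Fin 3 → ZFSet.{u}) => Q C (v 0) (v 1) (v 2))
    ![a, b, c] fun _ => Set.mem_univ _

theorem transfer₄ {M : Set ZFSet.{u}} (j : ElemEmb (Set.univ : Set ZFSet.{u}) M) (hM : TransClass M)
    (Q : Set ZFSet.{u} → ZFSet.{u} → ZFSet.{u} → ZFSet.{u} → ZFSet.{u} → Prop)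
    [Dfn (fun C (v : Fin 4 → ZFSet.{u}) => Q C (v 0) (v 1) (v 2) (v 3))]
    (a b c d : ZFSet.{u}) : Q Set.univ a b c d ↔ Q M (j.toFun a) (j.toFun b) (j.toFun c) (j.toFun d) :=
  j.transfer transClass_univ hM (fun C (v : Fin 4 → ZFSet.{u}) => Q C (v 0) (v 1) (v 2) (v 3))
    ![a, b, c, d] fun _ => Set.mem_univ _

end ElemEmb

/-- The image of the set `P` under an arbitrary function on the universe. -/
noncomputable def zimg (g : ZFSet.{u} → ZFSet.{u}) (P : ZFSet.{u}) : ZFSet.{u} :=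
  ZFSet.range (fun p : {p // p ∈ P} => g p)

theorem mem_zimg {g : ZFSet.{u} → ZFSet.{u}} {P y : ZFSet.{u}} :
    y ∈ zimg g P ↔ ∃ p ∈ P, g p = y := by
  simp [zimg]

/-- The restriction of `g` to `P`, as a set of pairs. -/
noncomputable def graph (P : ZFSet.{u}) (g : ZFSet.{u} → ZFSet.{u}) : ZFSet.{u} :=
  zimg (fun p => p.pair (g p)) P

theorem pair_mem_graph {P p y : ZFSet.{u}} {g : ZFSet.{u} → ZFSet.{u}} :
    p.pair y ∈ graph P g ↔ p ∈ P ∧ g p = y := by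
  simp only [graph, mem_zimg, ZFSet.pair_inj]
  constructor
  · rintro ⟨_, h, rfl, rfl⟩; exact ⟨h, rfl⟩
  · rintro ⟨h, rfl⟩; exact ⟨p, h, rfl, rfl⟩

theorem mem_graph {P z : ZFSet.{u}} {g : ZFSet.{u} → ZFSet.{u}} :
    z ∈ graph P g ↔ ∃ p ∈ P, z = p.pair (g p) := by
  simp only [graph, mem_zimg, eq_comm]

theorem small_of_forall_mem {p : ZFSet.{u} → Prop} (x : ZFSet.{u}) (h : ∀ y, p y → y ∈ x) :
    Small.{u} {y // p y} := by
  have : Small.{u} {y | y ∈ x} := inferInstanceAs (Small.{u} x)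
  exact small_subset (s := {y | y ∈ x}) (t := {y | p y}) h

/-! ### Well-founded collapse -/

section Collapse
variable {α : Type*} {r : α → α → Prop}

/-- The Mostowski collapse of a well-founded set-like relation. -/
noncomputable def coll (hr : WellFounded r) (hs : ∀ x, Small.{u} {y // r y x}) : α → ZFSet.{u} :=
  hr.fix fun x ih =>
    haveI := hs x
    ZFSet.range (fun y : {y // r y x} => ih y.1 y.2)

variable (hr : WellFounded r) (hs : ∀ x, Small.{u} {y // r y x})

theorem mem_coll {x : α} {z : ZFSet.{u}} :
    z ∈ coll hr hs x ↔ ∃ y, r y x ∧ coll hr hs y = z := by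
  rw [coll, hr.fix_eq]
  simp

theorem coll_isOrd (ht : ∀ x y z, r x y → r y z → r x z) (x : α) : IsOrd (coll hr hs x) := by
  have h : ∀ x, (coll hr hs x).IsTransitive := fun x z hz w hw => by
    obtain ⟨y, hy, rfl⟩ := (mem_coll hr hs).1 hz
    obtain ⟨t, ht', rfl⟩ := (mem_coll hr hs).1 hw
    exact (mem_coll hr hs).2 ⟨t, ht _ _ _ ht' hy, rfl⟩
  refine ⟨h x, fun y hy => ?_⟩
  obtain ⟨y, _, rfl⟩ := (mem_coll hr hs).1 hy
  exact h y

theorem coll_injective (htri : ∀ x y, r x y ∨ x = y ∨ r y x) :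
    Function.Injective (coll hr hs) := fun x y hxy => by
  rcases htri x y with h | h | h
  · have : coll hr hs x ∈ coll hr hs y := (mem_coll hr hs).2 ⟨x, h, rfl⟩
    rw [hxy] at this
    exact absurd this (ZFSet.mem_irrefl _)
  · exact h
  · have : coll hr hs y ∈ coll hr hs x := (mem_coll hr hs).2 ⟨y, h, rfl⟩
    rw [hxy] at this
    exact absurd this (ZFSet.mem_irrefl _)

end Collapse

/-! ### Mostowski collapse of extensional classes -/

/-- The transitive collapse of the class `H`. -/
noncomputable def mos (H : Set ZFSet.{u}) : ZFSet.{u} → ZFSet.{u} :=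
  coll (r := fun y x => y ∈ x ∧ y ∈ H)
    (Subrelation.wf (fun h => And.left h) ZFSet.mem_wf)
    fun x => small_of_forall_mem x fun _ h => And.left h

section Mos
variable {H : Set ZFSet.{u}}

theorem mem_mos {x z : ZFSet.{u}} : z ∈ mos H x ↔ ∃ y, (y ∈ x ∧ y ∈ H) ∧ mos H y = z :=
  mem_coll _ _

theorem mos_injOn (hH : ∀ x ∈ H, ∀ y ∈ H, (∀ z ∈ H, z ∈ x ↔ z ∈ y) → x = y) :
    ∀ x ∈ H, ∀ y ∈ H, mos H x = mos H y → x = y := by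
  intro x
  induction x using ZFSet.inductionOn with
  | _ x ih =>
    intro hx y hy hxy
    refine hH x hx y hy fun z hz => ⟨fun h => ?_, fun h => ?_⟩
    · have : mos H z ∈ mos H y := hxy ▸ mem_mos.2 ⟨z, ⟨h, hz⟩, rfl⟩
      obtain ⟨w, ⟨hw, hwH⟩, hwz⟩ := mem_mos.1 this
      rwa [ih z h hz w hwH hwz.symm]
    · have : mos H z ∈ mos H x := hxy ▸ mem_mos.2 ⟨z, ⟨h, hz⟩, rfl⟩
      obtain ⟨w, ⟨hw, hwH⟩, hwz⟩ := mem_mos.1 this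
      rwa [← ih w hw hwH z hz hwz]

theorem mos_mem_mos (hH : ∀ x ∈ H, ∀ y ∈ H, (∀ z ∈ H, z ∈ x ↔ z ∈ y) → x = y)
    {x y : ZFSet.{u}} (hx : x ∈ H) : mos H x ∈ mos H y ↔ x ∈ y := by
  refine ⟨fun h => ?_, fun h => mem_mos.2 ⟨x, ⟨h, hx⟩, rfl⟩⟩
  obtain ⟨w, ⟨hw, hwH⟩, hwz⟩ := mem_mos.1 h
  rwa [← mos_injOn hH w hwH x hx hwz]

theorem mos_eq_self {T : ZFSet.{u}} (hT : T.IsTransitive) (hTH : ∀ x ∈ T, x ∈ H) :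
    ∀ x ∈ T, mos H x = x := by
  intro x
  induction x using ZFSet.inductionOn with
  | _ x ih =>
    intro hx
    ext z
    rw [mem_mos]
    constructor
    · rintro ⟨y, ⟨hy, _⟩, rfl⟩
      rwa [ih y hy (hT x hx hy)]
    · intro hz
      exact ⟨z, ⟨hz, hTH z (hT x hx hz)⟩, ih z hz (hT x hx hz)⟩

theorem transClass_mos : TransClass (mos H '' H) := by
  rintro _ ⟨x, _, rfl⟩ y hy
  obtain ⟨w, ⟨_, hwH⟩, rfl⟩ := mem_mos.1 hy
  exact ⟨w, hwH, rfl⟩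

theorem realize_mos (hH : ∀ x ∈ H, ∀ y ∈ H, (∀ z ∈ H, z ∈ x ↔ z ∈ y) → x = y)
    {n : ℕ} (φ : Fml n) : ∀ v : Fin n → ZFSet.{u}, (∀ i, v i ∈ H) →
    (φ.Realize H v ↔ φ.Realize (mos H '' H) (fun i => mos H (v i))) := by
  induction φ with
  | mem i j => intro v hv; exact (mos_mem_mos hH (hv i)).symm
  | eq i j => intro v hv; exact ⟨congrArg _, mos_injOn hH _ (hv i) _ (hv j)⟩
  | not φ ih => intro v hv; exact not_congr (ih v hv)
  | and φ ψ ih ih' => intro v hv; exact and_congr (ih v hv) (ih' v hv)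
  | ex φ ih =>
    intro v hv
    simp only [Fml.Realize]
    rw [Set.exists_mem_image]
    refine exists_congr fun x => and_congr_right fun hx => ?_
    rw [ih]
    · refine iff_of_eq (congrArg _ (funext fun i => ?_))
      refine Fin.lastCases ?_ (fun i => ?_) i <;> simp
    · intro i
      refine Fin.lastCases ?_ (fun i => ?_) i <;> simp [hx, hv]

end Mos

/-! ### Extender ultrapowers -/

/-- The class of all values `j(g)(σ)`, where `(P, σ)` is an index and `g : P → U`. -/
def UltClass (U : Set ZFSet.{u}) (j : ZFSet.{u} → ZFSet.{u})
    (Idx : ZFSet.{u} → ZFSet.{u} → Prop) : Set ZFSet.{u} :=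
  {y | ∃ P σ g, Idx P σ ∧ (∀ p ∈ P, g p ∈ U) ∧ ZFSet.pair σ y ∈ j (graph P g)}

/-- A directed system of indices `σ ∈ j(P)`. -/
structure IsIndexSystem (j : ZFSet.{u} → ZFSet.{u})
    (Idx : ZFSet.{u} → ZFSet.{u} → Prop) : Prop where
  nonempty : ∃ P σ, Idx P σ
  mem : ∀ {P σ}, Idx P σ → σ ∈ j P
  directed : ∀ {P σ P' σ'}, Idx P σ → Idx P' σ' → ∃ Q τ a a', Idx Q τ ∧
    (∀ q ∈ Q, a q ∈ P) ∧ (∀ q ∈ Q, a' q ∈ P') ∧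
    ZFSet.pair τ σ ∈ j (graph Q a) ∧ ZFSet.pair τ σ' ∈ j (graph Q a')

section Los

/-- The set of `p ∈ P` with `U ⊨ φ(g(p))`. -/
noncomputable def losSet (U : Set ZFSet.{u}) (P : ZFSet.{u}) {n : ℕ} (φ : Fml n)
    (g : Fin n → ZFSet.{u} → ZFSet.{u}) : ZFSet.{u} :=
  P.sep fun p => φ.Realize U (fun i => g i p)

theorem mem_losSet {U : Set ZFSet.{u}} {P p : ZFSet.{u}} {n : ℕ} {φ : Fml n}
    {g : Fin n → ZFSet.{u} → ZFSet.{u}} :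
    p ∈ losSet U P φ g ↔ p ∈ P ∧ φ.Realize U (fun i => g i p) := by
  simp [losSet]

theorem ElemEmb.exists_pair_mem_graph {M : Set ZFSet.{u}} (j : ElemEmb (Set.univ : Set ZFSet.{u}) M)
    (hM : TransClass M) {P σ : ZFSet.{u}} (hσ : σ ∈ j.toFun P) (g : ZFSet.{u} → ZFSet.{u}) :
    ∃ y, σ.pair y ∈ j.toFun (graph P g) := by
  have := (j.transfer₂ hM (fun C P G => ∀ p ∈ P, ∃ y ∈ C, p.pair y ∈ G) P (graph P g)).1
    (by simp +contextual [pair_mem_graph])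
  obtain ⟨y, _, hy⟩ := this σ hσ
  exact ⟨y, hy⟩

theorem ElemEmb.pair_mem_graph_comp {M : Set ZFSet.{u}} (j : ElemEmb (Set.univ : Set ZFSet.{u}) M)
    (hM : TransClass M) {P Q σ τ y : ZFSet.{u}} {g a : ZFSet.{u} → ZFSet.{u}}
    (hτ : τ.pair σ ∈ j.toFun (graph Q a)) (hσ : σ.pair y ∈ j.toFun (graph P g)) :
    τ.pair y ∈ j.toFun (graph Q (fun q => g (a q))) := by
  have := (j.transfer₃ hM (fun C A G B => ∀ q ∈ C, ∀ p ∈ C, ∀ y ∈ C,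
      q.pair p ∈ A → p.pair y ∈ G → q.pair y ∈ B)
    (graph Q a) (graph P g) (graph Q (fun q => g (a q)))).1
    (by simp +contextual [pair_mem_graph])
  have h1 := hM.of_pair_mem (hM _ (j.maps _ (mem_univ _)) _ hτ)
  have h2 := hM.of_pair_mem (hM _ (j.maps _ (mem_univ _)) _ hσ)
  exact this _ h1.1 _ h1.2 _ h2.2 hτ hσ

theorem los {M : Set ZFSet.{u}} (j : ElemEmb (Set.univ : Set ZFSet.{u}) M) (hM : TransClass M)
    {U : Set ZFSet.{u}} (hU : U.Nonempty) {Idx : ZFSet.{u} → ZFSet.{u} → Prop}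
    (hI : IsIndexSystem j.toFun Idx) {n : ℕ} (φ : Fml n) :
    ∀ {P σ : ZFSet.{u}}, Idx P σ → ∀ (g : Fin n → ZFSet.{u} → ZFSet.{u}) (y : Fin n → ZFSet.{u}),
      (∀ i, ∀ p ∈ P, g i p ∈ U) → (∀ i, σ.pair (y i) ∈ j.toFun (graph P (g i))) →
      (φ.Realize (UltClass U j.toFun Idx) y ↔ σ ∈ j.toFun (losSet U P φ g)) := by
  have hMj : ∀ x, j.toFun x ∈ M := fun x => j.maps _ (mem_univ _)
  have hMp : ∀ {σ y x}, ZFSet.pair σ y ∈ j.toFun x → σ ∈ M ∧ y ∈ M := fun h =>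
    hM.of_pair_mem (hM _ (hMj _) _ h)
  induction φ with
  | mem i k =>
    intro P σ hP g y hg hy
    have := (j.transfer₃ hM (fun C G G' T => ∀ p ∈ C, ∀ a ∈ C, ∀ b ∈ C, p.pair a ∈ G →
        p.pair b ∈ G' → (a ∈ b ↔ p ∈ T)) (graph P (g i)) (graph P (g k))
        (losSet U P (.mem i k) g)).1
      (by simp +contextual [pair_mem_graph, mem_losSet, Fml.Realize])
    exact this _ (hMp (hy i)).1 _ (hMp (hy i)).2 _ (hMp (hy k)).2 (hy i) (hy k)
  | eq i k =>
    intro P σ hP g y hg hy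
    have := (j.transfer₃ hM (fun C G G' T => ∀ p ∈ C, ∀ a ∈ C, ∀ b ∈ C, p.pair a ∈ G →
        p.pair b ∈ G' → (a = b ↔ p ∈ T)) (graph P (g i)) (graph P (g k))
        (losSet U P (.eq i k) g)).1
      (by simp +contextual [pair_mem_graph, mem_losSet, Fml.Realize])
    exact this _ (hMp (hy i)).1 _ (hMp (hy i)).2 _ (hMp (hy k)).2 (hy i) (hy k)
  | not φ ih =>
    intro P σ hP g y hg hy
    have := (j.transfer₃ hM (fun _ P T T' => ∀ p ∈ P, (¬ p ∈ T ↔ p ∈ T')) P (losSet U P φ g)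
        (losSet U P φ.not g)).1
      (by simp +contextual [mem_losSet, Fml.Realize])
    rw [← this σ (hI.mem hP), ← ih hP g y hg hy]
    rfl
  | and φ ψ ih ih' =>
    intro P σ hP g y hg hy
    have := (j.transfer₄ hM (fun _ P T T' T'' => ∀ p ∈ P, (p ∈ T ∧ p ∈ T' ↔ p ∈ T'')) P
        (losSet U P φ g) (losSet U P ψ g) (losSet U P (φ.and ψ) g)).1
      (by simp +contextual [mem_losSet, Fml.Realize])
    rw [← this σ (hI.mem hP), ← ih hP g y hg hy, ← ih' hP g y hg hy]
    rfl
  | @ex n φ ih =>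
    intro P σ hP g y hg hy
    constructor
    · rintro ⟨x, ⟨P', σ', g', hP', hg', hx⟩, hφ⟩
      obtain ⟨Q, τ, a, a', hQ, ha, ha', hτ, hτ'⟩ := hI.directed hP hP'
      let G : Fin (n + 1) → ZFSet.{u} → ZFSet.{u} :=
        Fin.snoc (α := fun _ => ZFSet.{u} → ZFSet.{u}) (fun i q => g i (a q)) (fun q => g' (a' q))
      have h1 := (ih hQ G (Fin.snoc y x) ?_ ?_).1 hφ
      · have := (j.transfer₃ hM (fun C A T T' => ∀ q ∈ C, ∀ p ∈ C, q.pair p ∈ A →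
            q ∈ T → p ∈ T') (graph Q a) (losSet U Q φ G) (losSet U P φ.ex g)).1 (by
          simp only [mem_univ, forall_const, pair_mem_graph, mem_losSet]
          rintro q _ ⟨hq, rfl⟩ ⟨-, h⟩
          refine ⟨ha q hq, g' (a' q), hg' _ (ha' q hq), ?_⟩
          convert h using 2 with i
          refine Fin.lastCases ?_ (fun i => ?_) i <;> simp [G])
        exact this _ (hMp hτ).1 _ (hMp hτ).2 hτ h1
      · intro i
        refine Fin.lastCases ?_ (fun i => ?_) i
        · simpa [G] using fun q hq => hg' _ (ha' q hq)
        · simpa [G] using fun q hq => hg i _ (ha q hq)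
      · intro i
        refine Fin.lastCases ?_ (fun i => ?_) i
        · simpa [G] using j.pair_mem_graph_comp hM hτ' hx
        · simpa [G] using j.pair_mem_graph_comp hM hτ (hy i)
    · intro hσ
      have hex : ∀ p, ∃ x ∈ U, (∃ x ∈ U, φ.Realize U (Fin.snoc (fun i => g i p) x)) →
          φ.Realize U (Fin.snoc (fun i => g i p) x) := by
        intro p
        by_cases h : ∃ x ∈ U, φ.Realize U (Fin.snoc (fun i => g i p) x)
        · obtain ⟨x, hx, hφ⟩ := h
          exact ⟨x, hx, fun _ => hφ⟩
        · obtain ⟨x, hx⟩ := hU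
          exact ⟨x, hx, fun h' => absurd h' h⟩
      choose g' hg' hφ' using hex
      let G : Fin (n + 1) → ZFSet.{u} → ZFSet.{u} :=
        Fin.snoc (α := fun _ => ZFSet.{u} → ZFSet.{u}) g g'
      obtain ⟨x, hx⟩ := j.exists_pair_mem_graph hM (hI.mem hP) g'
      refine ⟨x, ⟨P, σ, g', hP, fun p _ => hg' p, hx⟩, (ih hP G (Fin.snoc y x) ?_ ?_).2 ?_⟩
      · intro i
        refine Fin.lastCases ?_ (fun i => ?_) i
        · simpa [G] using fun p _ => hg' p
        · simpa [G] using hg i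
      · intro i
        refine Fin.lastCases ?_ (fun i => ?_) i
        · simpa [G] using hx
        · simpa [G] using hy i
      · have : losSet U P φ.ex g = losSet U P φ G := by
          ext p
          simp only [mem_losSet]
          refine and_congr_right fun hp => ?_
          have hG : (fun i => G i p) = Fin.snoc (fun i => g i p) (g' p) := by
            ext1 i
            refine Fin.lastCases ?_ (fun i => ?_) i <;> simp [G]
          rw [hG]
          exact ⟨fun h => hφ' p h, fun h => ⟨_, hg' p, h⟩⟩
        rwa [← this]

end Los

theorem sat_extAx (C : Set ZFSet.{u}) :
    Sat C extAx ↔ ∀ x ∈ C, ∀ y ∈ C, (∀ z ∈ C, z ∈ x ↔ z ∈ y) → x = y := by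
  simp only [Sat, extAx, Fml.all, Fml.imp, Fml.or, Fml.iff, Fml.Realize]
  push Not
  refine forall₂_congr fun x _ => forall₂_congr fun y _ => ?_
  simp only [Fin.snoc]
  refine imp_congr (forall₂_congr fun z _ => ?_) Iff.rfl
  simp
  tauto

namespace ElemEmb

theorem map_empty {M : Set ZFSet.{u}} (j : ElemEmb (Set.univ : Set ZFSet.{u}) M) (hM : TransClass M) :
    j.toFun ∅ = ∅ := by
  have := (j.transfer₁ hM (fun _ a => ∀ x ∈ a, ¬ x = x) ∅).1 (by simp)
  ext z
  simpa using this z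

theorem map_mem_iff {W M : Set ZFSet.{u}} (j : ElemEmb W M) {a b : ZFSet.{u}} (ha : a ∈ W)
    (hb : b ∈ W) : j.toFun a ∈ j.toFun b ↔ a ∈ b :=
  by
  simpa [Fml.Realize] using (j.elem (.mem 0 1) ![a, b] (by simp [ha, hb])).symm

theorem map_subset {M : Set ZFSet.{u}} (j : ElemEmb (Set.univ : Set ZFSet.{u}) M) (hM : TransClass M)
    {a b : ZFSet.{u}} (h : a ⊆ b) : j.toFun a ⊆ j.toFun b :=
  (j.transfer₂ hM (fun _ a b => ∀ x ∈ a, x ∈ b) a b).1 fun _ hx => h hx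

theorem pair_mem_graph_const {M : Set ZFSet.{u}} (j : ElemEmb (Set.univ : Set ZFSet.{u}) M) (hM : TransClass M)
    {P σ : ZFSet.{u}} (hσ : σ ∈ j.toFun P) (a : ZFSet.{u}) :
    σ.pair (j.toFun a) ∈ j.toFun (graph P fun _ => a) :=
  (j.transfer₃ hM (fun _ P a G => ∀ p ∈ P, p.pair a ∈ G) P a (graph P fun _ => a)).1
    (by simp +contextual [pair_mem_graph]) σ hσ

variable {M : Set ZFSet.{u}} (j : ElemEmb (Set.univ : Set ZFSet.{u}) M) {U : Set ZFSet.{u}}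
  {Idx : ZFSet.{u} → ZFSet.{u} → Prop}

theorem map_mem_ultClass (hM : TransClass M) (hI : IsIndexSystem j.toFun Idx)
    {a : ZFSet.{u}} (ha : a ∈ U) : j.toFun a ∈ UltClass U j.toFun Idx := by
  obtain ⟨P, σ, hP⟩ := hI.nonempty
  exact ⟨P, σ, fun _ => a, hP, fun _ _ => ha, j.pair_mem_graph_const hM (hI.mem hP) a⟩

theorem realize_ultClass (hM : TransClass M) (hU : U.Nonempty) (hI : IsIndexSystem j.toFun Idx)
    {n : ℕ} (φ : Fml n) (v : Fin n → ZFSet.{u}) (hv : ∀ i, v i ∈ U) :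
    φ.Realize U v ↔ φ.Realize (UltClass U j.toFun Idx) (fun i => j.toFun (v i)) := by
  obtain ⟨P, σ, hP⟩ := hI.nonempty
  rw [los j hM hU hI φ hP (fun i _ => v i) _ (fun i _ _ => hv i)
    fun i => j.pair_mem_graph_const hM (hI.mem hP) _]
  by_cases h : φ.Realize U v
  · have : losSet U P φ (fun i _ => v i) = P := by ext; simp [mem_losSet, h]
    simpa [this, h] using hI.mem hP
  · have : losSet U P φ (fun i _ => v i) = ∅ := by ext; simp [mem_losSet, h]
    simp [this, h, j.map_empty hM]

theorem ultClass_ext (hM : TransClass M) (hU : U.Nonempty) (hUt : TransClass U)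
    (hI : IsIndexSystem j.toFun Idx) :
    ∀ x ∈ UltClass U j.toFun Idx, ∀ y ∈ UltClass U j.toFun Idx,
      (∀ z ∈ UltClass U j.toFun Idx, z ∈ x ↔ z ∈ y) → x = y := by
  refine (sat_extAx _).1 ?_
  have h : Sat U extAx := (sat_extAx U).2 fun x hx y hy h => by
    ext z
    exact ⟨fun hz => (h z (hUt x hx z hz)).1 hz, fun hz => (h z (hUt y hy z hz)).2 hz⟩
  have h' := (j.realize_ultClass hM hU hI extAx _ fun i => i.elim0).1 h
  rwa [Subsingleton.elim (fun i : Fin 0 => j.toFun i.elim0) fun i => i.elim0] at h'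

/-- The elementary embedding of `U` into the collapsed extender ultrapower. -/
noncomputable def ultEmb (hM : TransClass M) (hU : U.Nonempty) (hUt : TransClass U)
    (hI : IsIndexSystem j.toFun Idx) :
    ElemEmb U (mos (UltClass U j.toFun Idx) '' UltClass U j.toFun Idx) where
  toFun x := mos (UltClass U j.toFun Idx) (j.toFun x)
  maps _ hx := ⟨_, j.map_mem_ultClass hM hI hx, rfl⟩
  elem φ v hv := (j.realize_ultClass hM hU hI φ v hv).trans
    (realize_mos (j.ultClass_ext hM hU hUt hI) φ _ fun i => j.map_mem_ultClass hM hI (hv i))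

end ElemEmb

/-! ### Cardinality and ordinals -/

theorem isOrd_iff {x : ZFSet.{u}} : IsOrd x ↔ x.IsOrdinal :=
  ZFSet.isOrdinal_iff_forall_mem_isTransitive.symm

theorem card_le_mk {a : ZFSet.{u}} {α : Type u} (F : {x // x ∈ a} → α)
    (hF : Function.Injective F) : a.card ≤ Cardinal.mk α :=
  Cardinal.mk_le_of_injective (f := fun x : Shrink.{u} a => F ((equivShrink a).symm x))
    (hF.comp (equivShrink a).symm.injective)

theorem card_le_of_injOn {a b : ZFSet.{u}} {F : ZFSet.{u} → ZFSet.{u}} (hF : ∀ x ∈ a, F x ∈ b)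
    (hinj : ∀ x ∈ a, ∀ y ∈ a, F x = F y → x = y) : a.card ≤ b.card :=
  card_le_mk (fun x => equivShrink b ⟨F x.1, hF _ x.2⟩) fun x y h => by
    exact Subtype.ext (hinj x x.2 y y.2 (congrArg Subtype.val ((equivShrink b).injective h)))

theorem exists_injOn_of_card_le {a b : ZFSet.{u}} (h : a.card ≤ b.card) :
    ∃ F : ZFSet.{u} → ZFSet.{u}, (∀ x ∈ a, F x ∈ b) ∧ ∀ x ∈ a, ∀ y ∈ a, F x = F y → x = y := by
  classical
  obtain ⟨f⟩ := Cardinal.le_def _ _ |>.1 h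
  refine ⟨fun x => if hx : x ∈ a then ((equivShrink b).symm (f (equivShrink a ⟨x, hx⟩))).1 else ∅,
    fun x hx => ?_, fun x hx y hy h => ?_⟩
  · simp only [hx, dite_true]
    exact ((equivShrink b).symm _).2
  · simp only [hx, hy, dite_true] at h
    have := (equivShrink a).injective (f.injective ((equivShrink b).symm.injective
      (Subtype.ext h)))
    exact congrArg Subtype.val this

theorem isFuncOn_graph (P : ZFSet.{u}) (g : ZFSet.{u} → ZFSet.{u}) : IsFuncOn P (graph P g) := by
  refine ⟨fun p hp => ?_, fun a ha => ⟨g a, pair_mem_graph.2 ⟨ha, rfl⟩, fun y hy => ?_⟩⟩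
  · obtain ⟨a, ha, rfl⟩ := mem_graph.1 hp
    exact ⟨a, _, ha, rfl⟩
  · exact (pair_mem_graph.1 hy).2.symm

theorem exists_inj_iff_card_le {a b : ZFSet.{u}} :
    (∃ f : ZFSet.{u}, IsFuncOn a f ∧ MapsInto f b ∧ InjFun f) ↔ a.card ≤ b.card := by
  constructor
  · rintro ⟨f, hf, hb, hinj⟩
    have : ∀ x, ∃ y, x ∈ a → x.pair y ∈ f := fun x => by
      by_cases hx : x ∈ a
      · obtain ⟨y, hy, _⟩ := hf.2 x hx
        exact ⟨y, fun _ => hy⟩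
      · exact ⟨∅, fun h => absurd h hx⟩
    choose F hF using this
    exact card_le_of_injOn (F := F) (fun x hx => hb _ _ (hF x hx))
      fun x hx y hy h => hinj _ _ (F x) (hF x hx) (h ▸ hF y hy)
  · intro h
    obtain ⟨F, hF, hinj⟩ := exists_injOn_of_card_le h
    refine ⟨graph a F, isFuncOn_graph a F, fun x y h => ?_, fun x x' y h h' => ?_⟩
    · rw [pair_mem_graph] at h
      exact h.2 ▸ hF x h.1
    · rw [pair_mem_graph] at h h'
      exact hinj x h.1 x' h'.1 (h.2.trans h'.2.symm)

theorem setLeIn_univ {a b : ZFSet.{u}} : SetLeIn Set.univ a b ↔ a.card ≤ b.card := by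
  rw [← exists_inj_iff_card_le]
  simp [SetLeIn]

theorem cardLtIn_univ {s t : ZFSet.{u}} : CardLtIn Set.univ s t ↔ ∃ β ∈ t, s.card ≤ β.card := by
  simp only [CardLtIn, ← exists_inj_iff_card_le, mem_univ, true_and]
  exact ⟨fun ⟨β, f, h, h'⟩ => ⟨β, h, f, h'⟩, fun ⟨β, h, f, h'⟩ => ⟨β, f, h, h'⟩⟩

theorem card_zimg_le (g : ZFSet.{u} → ZFSet.{u}) (P : ZFSet.{u}) : (zimg g P).card ≤ P.card := by
  have : ∀ y, ∃ p, y ∈ zimg g P → p ∈ P ∧ g p = y := fun y => by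
    by_cases hy : y ∈ zimg g P
    · obtain ⟨p, hp⟩ := mem_zimg.1 hy
      exact ⟨p, fun _ => hp⟩
    · exact ⟨∅, fun h => absurd h hy⟩
  choose F hF using this
  exact card_le_of_injOn (F := F) (fun x hx => (hF x hx).1)
    fun x hx y hy h => by rw [← (hF x hx).2, h, (hF y hy).2]

theorem card_prod_le (a b : ZFSet.{u}) : (a.prod b).card ≤ a.card * b.card := by
  have : ∀ z : {z // z ∈ a.prod b}, ∃ x : a, ∃ y : b, z.1 = x.1.pair y.1 := by
    rintro ⟨z, hz⟩
    obtain ⟨x, hx, y, hy, rfl⟩ := ZFSet.mem_prod.1 hz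
    exact ⟨⟨x, hx⟩, ⟨y, hy⟩, rfl⟩
  choose F G h using this
  refine (card_le_mk (α := Shrink.{u} a × Shrink.{u} b)
    (fun z => (equivShrink a (F z), equivShrink b (G z))) fun z w hzw => ?_).trans_eq
      (by rw [Cardinal.mk_prod, Cardinal.lift_id, Cardinal.lift_id]; rfl)
  obtain ⟨h1, h2⟩ := Prod.mk.inj hzw
  refine Subtype.ext ?_
  rw [h, h, (equivShrink a).injective h1, (equivShrink b).injective h2]

/-- The union of the sets `Z x`, for `x ∈ X`. -/
noncomputable def bUnion (Z : ZFSet.{u} → ZFSet.{u}) (X : ZFSet.{u}) : ZFSet.{u} :=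
  ZFSet.sUnion (zimg Z X)

theorem mem_bUnion {Z : ZFSet.{u} → ZFSet.{u}} {X z : ZFSet.{u}} :
    z ∈ bUnion Z X ↔ ∃ x ∈ X, z ∈ Z x := by
  simp [bUnion, mem_zimg]

theorem card_bUnion_le {Z : ZFSet.{u} → ZFSet.{u}} {X c : ZFSet.{u}}
    (hX : X.card ≤ c.card) (hZ : ∀ x ∈ X, (Z x).card ≤ c.card) (hc : Cardinal.aleph0 ≤ c.card) :
    (bUnion Z X).card ≤ c.card := by
  have h1 : ∀ x, ∃ F : ZFSet.{u} → ZFSet.{u}, x ∈ X → (∀ z ∈ Z x, F z ∈ c) ∧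
      ∀ z ∈ Z x, ∀ w ∈ Z x, F z = F w → z = w := fun x => by
    by_cases hx : x ∈ X
    · obtain ⟨F, hF⟩ := exists_injOn_of_card_le (hZ x hx)
      exact ⟨F, fun _ => hF⟩
    · exact ⟨id, fun h => absurd h hx⟩
  choose F hF using h1
  have h2 : ∀ z, ∃ x, z ∈ bUnion Z X → x ∈ X ∧ z ∈ Z x := fun z => by
    by_cases hz : z ∈ bUnion Z X
    · obtain ⟨x, hx⟩ := mem_bUnion.1 hz
      exact ⟨x, fun _ => hx⟩
    · exact ⟨∅, fun h => absurd h hz⟩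
  choose G hG using h2
  refine (card_le_of_injOn (F := fun z => (G z).pair (F (G z) z)) (b := X.prod c)
    (fun z hz => ?_) fun z hz w hw h => ?_).trans ((card_prod_le _ _).trans
      ((mul_le_mul' hX le_rfl).trans (Cardinal.mul_eq_self hc).le))
  · exact ZFSet.pair_mem_prod.2 ⟨(hG z hz).1, (hF _ (hG z hz).1).1 z (hG z hz).2⟩
  · obtain ⟨h1, h2⟩ := ZFSet.pair_inj.1 h
    rw [← h1] at h2
    exact (hF _ (hG z hz).1).2 z (hG z hz).2 w (h1 ▸ (hG w hw).2) h2

theorem IsCrit.aleph0_le_card {M : Set ZFSet.{u}} (hM : TransClass M)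
    {j : ElemEmb (Set.univ : Set ZFSet.{u}) M} {κ : ZFSet.{u}} (hκ : IsCrit j κ) :
    Cardinal.aleph0 ≤ κ.card := by
  obtain ⟨ho, hne, hfix⟩ := hκ
  have hoκ := isOrd_iff.1 ho
  rw [← hoκ.toZFSet_rank_eq, Ordinal.card_toZFSet, Ordinal.aleph0_le_card]
  rcases Ordinal.zero_or_succ_or_isSuccLimit κ.rank with h | ⟨o, h⟩ | h
  · exfalso
    have : κ = ∅ := by rw [← hoκ.toZFSet_rank_eq, h, Ordinal.toZFSet_zero]
    exact hne (by rw [this, j.map_empty hM])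
  · exfalso
    have hk : κ = insert o.toZFSet o.toZFSet := by
      rw [← hoκ.toZFSet_rank_eq, ← h, Order.succ_eq_add_one, Ordinal.toZFSet_add_one]
    have ho : j.toFun o.toZFSet = o.toZFSet := hfix _ (by simp [hk])
    have := (j.transfer₂ hM (fun C κ a => ∀ x ∈ C, x ∈ κ ↔ x = a ∨ x ∈ a) κ o.toZFSet).1
      (by simp [hk])
    refine hne (ZFSet.ext fun x => ?_)
    rw [ho] at this
    conv_rhs => rw [hk, ZFSet.mem_insert_iff]
    refine ⟨fun hx => (this x (hM _ (j.maps _ (mem_univ _)) _ hx)).1 hx, fun hx => ?_⟩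
    have hoM : o.toZFSet ∈ M := ho ▸ j.maps _ (mem_univ _)
    refine (this x ?_).2 hx
    rcases hx with rfl | hx
    exacts [hoM, hM _ hoM _ hx]
  · exact Ordinal.omega0_le_of_isSuccLimit h

namespace ElemEmb
variable {M : Set ZFSet.{u}} (j : ElemEmb (Set.univ : Set ZFSet.{u}) M)

theorem map_mem_target (x : ZFSet.{u}) : j.toFun x ∈ M := j.maps x (mem_univ x)

theorem mem_target (hM : TransClass M) {x y : ZFSet.{u}} (h : x ∈ j.toFun y) : x ∈ M :=
  hM _ (j.map_mem_target y) _ h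

theorem pair_mem_graph_id (hM : TransClass M) {P σ : ZFSet.{u}} (hσ : σ ∈ j.toFun P) :
    σ.pair σ ∈ j.toFun (graph P id) :=
  (j.transfer₂ hM (fun _ P G => ∀ p ∈ P, p.pair p ∈ G) P (graph P id)).1
    (by simp [pair_mem_graph]) σ hσ

/-- First-order properties that hold for all indices hold in the extender ultrapower. -/
theorem dfn_ult (hM : TransClass M) {Idx : ZFSet.{u} → ZFSet.{u} → Prop}
    (hI : IsIndexSystem j.toFun Idx) {P σ : ZFSet.{u}} (hP : Idx P σ) {ι : Type}
    (Q : Set ZFSet.{u} → (ι → ZFSet.{u}) → Prop) [h : Dfn Q] (g : ι → ZFSet.{u} → ZFSet.{u})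
    (y : ι → ZFSet.{u}) (hy : ∀ i, σ.pair (y i) ∈ j.toFun (graph P (g i)))
    (hQ : ∀ p ∈ P, Q Set.univ (fun i => g i p)) :
    Q (mos (UltClass Set.univ j.toFun Idx) '' UltClass Set.univ j.toFun Idx)
      (fun i => mos (UltClass Set.univ j.toFun Idx) (y i)) := by
  obtain ⟨n, f, φ, hφ⟩ := h.out
  have hyH : ∀ i, y i ∈ UltClass Set.univ j.toFun Idx := fun i =>
    ⟨P, σ, g i, hP, fun _ _ => mem_univ _, hy i⟩
  refine (hφ _ transClass_mos _ fun i => ⟨_, hyH i, rfl⟩).1 ?_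
  rw [← realize_mos (j.ultClass_ext hM univ_nonempty transClass_univ hI) φ (fun k => y (f k))
    fun k => hyH _]
  rw [los j hM univ_nonempty hI φ hP (fun k => g (f k)) _ (fun _ _ _ => mem_univ _)
    fun k => hy _]
  have : losSet Set.univ P φ (fun k => g (f k)) = P := by
    ext p
    simp only [mem_losSet, and_iff_left_iff_imp]
    exact fun hp => (hφ _ transClass_univ (fun i => g i p) fun _ => mem_univ _).2 (hQ p hp)
  rw [this]
  exact hI.mem hP

theorem dfn_ult_two (hM : TransClass M) {Idx : ZFSet.{u} → ZFSet.{u} → Prop}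
    (hI : IsIndexSystem j.toFun Idx) {P σ : ZFSet.{u}} (hP : Idx P σ)
    (Q : Set ZFSet.{u} → ZFSet.{u} → ZFSet.{u} → Prop)
    [Dfn (fun C (v : Fin 2 → ZFSet.{u}) => Q C (v 0) (v 1))] {g h : ZFSet.{u} → ZFSet.{u}}
    {y z : ZFSet.{u}} (hy : σ.pair y ∈ j.toFun (graph P g)) (hz : σ.pair z ∈ j.toFun (graph P h))
    (hQ : ∀ p ∈ P, Q Set.univ (g p) (h p)) :
    Q (mos (UltClass Set.univ j.toFun Idx) '' UltClass Set.univ j.toFun Idx)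
      (mos (UltClass Set.univ j.toFun Idx) y) (mos (UltClass Set.univ j.toFun Idx) z) :=
  j.dfn_ult hM hI hP (fun C (v : Fin 2 → ZFSet.{u}) => Q C (v 0) (v 1)) ![g, h] ![y, z]
    (Fin.forall_fin_two.2 ⟨hy, hz⟩) hQ

end ElemEmb

/-- A weak covering embedding yields an embedding with the full covering property. -/
theorem exists_covers_of_wCovers {N : Set ZFSet.{u}} (hN : TransClass N)
    (i : ElemEmb (Set.univ : Set ZFSet.{u}) N) {κ lam : ZFSet.{u}} (hκ : κ.IsTransitive)
    (hfix : ∀ α ∈ κ, i.toFun α = α) (hW : WCovers N i.toFun κ lam) :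
    ∃ N' : Set ZFSet.{u}, TransClass N' ∧ ∃ i' : ElemEmb (Set.univ : Set ZFSet.{u}) N',
      (∀ α ∈ κ, i'.toFun α = α) ∧ CoversIn Set.univ N' i'.toFun κ lam := by
  obtain ⟨s, hs, hls, hsc⟩ := hW
  let P := lam.powerset.sep fun p => CardLtIn Set.univ p κ
  obtain ⟨σ, hσP, hσ⟩ : ∃ σ ∈ i.toFun P, ∀ α ∈ lam, i.toFun α ∈ σ := by
    have := (i.transfer₃ hN (fun C l κ P => ∀ s ∈ C, CardLtIn C s κ →
        ∃ t ∈ P, ∀ x ∈ C, x ∈ s → x ∈ l → x ∈ t) lam κ P).1 (by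
      intro s _ hs
      refine ⟨lam.sep fun x => x ∈ s, ?_, fun x _ hxs hxl => ZFSet.mem_sep.2 ⟨hxl, hxs⟩⟩
      simp only [P, ZFSet.mem_sep, ZFSet.mem_powerset]
      refine ⟨fun x hx => (ZFSet.mem_sep.1 hx).1, ?_⟩
      obtain ⟨β, hβ, h⟩ := cardLtIn_univ.1 hs
      exact cardLtIn_univ.2 ⟨β, hβ, (ZFSet.card_mono fun x hx => (ZFSet.mem_sep.1 hx).2).trans h⟩)
    obtain ⟨σ, hσ, h⟩ := this s hs hsc
    exact ⟨σ, hσ, fun α hα => h _ (i.map_mem_target α) (hls α hα)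
      ((i.map_mem_iff (mem_univ _) (mem_univ _)).2 hα)⟩
  let Idx : ZFSet.{u} → ZFSet.{u} → Prop := fun P' σ' => P' = P ∧ σ' = σ
  have hI : IsIndexSystem i.toFun Idx := by
    refine ⟨⟨P, σ, rfl, rfl⟩, ?_, ?_⟩
    · rintro _ _ ⟨rfl, rfl⟩; exact hσP
    · rintro _ _ _ _ ⟨rfl, rfl⟩ ⟨rfl, rfl⟩
      exact ⟨P, _, id, id, ⟨rfl, rfl⟩, fun _ => id, fun _ => id, i.pair_mem_graph_id hN hσP,
        i.pair_mem_graph_id hN hσP⟩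
  set H := UltClass Set.univ i.toFun Idx with hH
  have hext := i.ultClass_ext hN univ_nonempty transClass_univ hI
  refine ⟨_, transClass_mos, i.ultEmb hN univ_nonempty transClass_univ hI, fun α hα => ?_, ?_⟩
  · change mos H (i.toFun α) = α
    rw [hfix α hα]
    refine mos_eq_self hκ (fun x hx => ?_) α hα
    rw [← hfix x hx]
    exact i.map_mem_ultClass hN hI (mem_univ _)
  · intro X _ hX hXl
    obtain ⟨F, hF, hFinj⟩ := exists_injOn_of_card_le (setLeIn_univ.1 hXl)
    have : ∀ x, ∃ y, ∃ g : ZFSet.{u} → ZFSet.{u}, x ∈ X →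
        mos H y = x ∧ y ∈ H ∧ σ.pair y ∈ i.toFun (graph P g) := fun x => by
      by_cases hx : x ∈ X
      · obtain ⟨y, hy, hyx⟩ := hX hx
        obtain ⟨_, _, g, ⟨rfl, rfl⟩, _, hg⟩ := id hy
        exact ⟨y, g, fun _ => ⟨hyx, hy, hg⟩⟩
      · exact ⟨∅, id, fun h => absurd h hx⟩
    choose y g hyg using this
    let S : ZFSet.{u} → ZFSet.{u} := fun p => zimg (fun x => g x p) (X.sep fun x => F x ∈ p)
    obtain ⟨t, ht⟩ := i.exists_pair_mem_graph hN hσP S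
    have htH : t ∈ H := ⟨P, σ, S, ⟨rfl, rfl⟩, fun _ _ => mem_univ _, ht⟩
    refine ⟨mos H t, ⟨t, htH, rfl⟩, fun x hx => ?_, ?_⟩
    · obtain ⟨h1, h2, h3⟩ := hyg x hx
      rw [← h1, mos_mem_mos hext h2]
      have := (i.transfer₃ hN (fun C G B α => ∀ p ∈ C, ∀ y ∈ C, ∀ t ∈ C, α ∈ p → p.pair y ∈ G →
          p.pair t ∈ B → y ∈ t) (graph P (g x)) (graph P S) (F x)).1 (by
        simp only [mem_univ, forall_const, pair_mem_graph]
        rintro p _ _ hp ⟨_, rfl⟩ ⟨_, rfl⟩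
        exact mem_zimg.2 ⟨x, ZFSet.mem_sep.2 ⟨hx, hp⟩, rfl⟩)
      exact this _ (i.mem_target hN hσP)
        _ (hN.of_pair_mem (i.mem_target hN h3)).2 _ (hN.of_pair_mem (i.mem_target hN ht)).2
        (hσ _ (hF x hx)) h3 ht
    · refine i.dfn_ult_two hN hI (P := P) (σ := σ) (And.intro rfl rfl) (fun C a b => CardLtIn C a b) ht
        (i.pair_mem_graph_const hN hσP κ) ?_
      · intro p hp
        obtain ⟨β, hβ, h⟩ := cardLtIn_univ.1 (ZFSet.mem_sep.1 hp).2
        refine cardLtIn_univ.2 ⟨β, hβ, le_trans ((card_zimg_le _ _).trans ?_) h⟩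
        exact card_le_of_injOn (F := F) (fun x hx => (ZFSet.mem_sep.1 hx).2)
          fun x hx y hy => hFinj x (ZFSet.mem_sep.1 hx).1 y (ZFSet.mem_sep.1 hy).1

open Cardinal

theorem exists_fst_fun : ∃ f : ZFSet.{u} → ZFSet.{u}, ∀ x y : ZFSet.{u}, f (x.pair y) = x :=
  ⟨fun q => Classical.epsilon fun x => ∃ y, q = x.pair y, fun x y => by
    obtain ⟨z, hz⟩ := Classical.epsilon_spec (p := fun a => ∃ b, x.pair y = a.pair b) ⟨x, y, rfl⟩
    exact (ZFSet.pair_inj.1 hz).1.symm⟩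

theorem exists_snd_fun : ∃ f : ZFSet.{u} → ZFSet.{u}, ∀ x y : ZFSet.{u}, f (x.pair y) = y :=
  ⟨fun q => Classical.epsilon fun y => ∃ x : ZFSet.{u}, q = x.pair y, fun x y => by
    obtain ⟨z, hz⟩ := Classical.epsilon_spec (p := fun b => ∃ a : ZFSet.{u}, x.pair y = a.pair b) ⟨y, x, rfl⟩
    exact (ZFSet.pair_inj.1 hz).2.symm⟩

/-- The indices `σ ∈ j(P)` with `|P| ≤ c`. -/
theorem isIndexSystem_card_le {M : Set ZFSet.{u}} (hM : TransClass M)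
    (j : ElemEmb (Set.univ : Set ZFSet.{u}) M) {c : Cardinal} (hc : ℵ₀ ≤ c) :
    IsIndexSystem j.toFun fun P σ => P.card ≤ c ∧ σ ∈ j.toFun P where
  nonempty := by
    refine ⟨{∅}, j.toFun ∅, ?_, (j.map_mem_iff (mem_univ _) (mem_univ _)).2 (by simp)⟩
    exact (ZFSet.card_singleton ▸ one_le_aleph0 : ZFSet.card {∅} ≤ ℵ₀).trans hc
  mem h := h.2
  directed := by
    rintro P σ P' σ' ⟨hP, hσ⟩ ⟨hP', hσ'⟩
    obtain ⟨f, hf⟩ := exists_fst_fun.{u}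
    obtain ⟨s, hs⟩ := exists_snd_fun.{u}
    have hQ := (j.transfer₃ hM (fun _ P P' Q => ∀ x ∈ P, ∀ y ∈ P', x.pair y ∈ Q)
      P P' (P.prod P')).1 (by simp +contextual)
    have h1 := (j.transfer₃ hM (fun C P P' G => ∀ x ∈ P, ∀ y ∈ P', ∀ q ∈ C, q = x.pair y →
        q.pair x ∈ G) P P' (graph (P.prod P') f)).1 (by
      rintro x hx y hy _ _ rfl
      simp [pair_mem_graph, hx, hy, hf])
    have h2 := (j.transfer₃ hM (fun C P P' G => ∀ x ∈ P, ∀ y ∈ P', ∀ q ∈ C, q = x.pair y →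
        q.pair y ∈ G) P P' (graph (P.prod P') s)).1 (by
      rintro x hx y hy _ _ rfl
      simp [pair_mem_graph, hx, hy, hs])
    have hτ := hQ _ hσ _ hσ'
    refine ⟨P.prod P', σ.pair σ', f, s, ⟨(card_prod_le _ _).trans ((mul_le_mul' hP hP').trans (Cardinal.mul_eq_self hc).le), hτ⟩, ?_, ?_,
      h1 _ hσ _ hσ' _ (j.mem_target hM hτ) rfl, h2 _ hσ _ hσ' _ (j.mem_target hM hτ) rfl⟩
    · intro q hq
      obtain ⟨x, hx, y, hy, rfl⟩ := ZFSet.mem_prod.1 hq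
      rwa [hf]
    · intro q hq
      obtain ⟨x, hx, y, hy, rfl⟩ := ZFSet.mem_prod.1 hq
      rwa [hs]

/-- The extender derived from `j`, applied to an inner class. -/
theorem exists_lift {M : Set ZFSet.{u}} (hM : TransClass M)
    (j : ElemEmb (Set.univ : Set ZFSet.{u}) M) {N₁ : Set ZFSet.{u}} (hN : TransClass N₁)
    (hne : N₁.Nonempty) {c : Cardinal} (hc : ℵ₀ ≤ c) :
    ∃ N : Set ZFSet.{u}, TransClass N ∧ ∃ k : ElemEmb N₁ N,
      (∀ y ∈ N, ∃ Z : ZFSet.{u}, (∀ z ∈ Z, z ∈ N₁) ∧ Z.card ≤ c ∧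
        ∀ t ∈ N₁, Z ⊆ t → y ∈ k.toFun t) ∧
      ∀ T : ZFSet.{u}, T.IsTransitive → (∀ x ∈ T, x ∈ N₁) → T.card ≤ c →
        (∀ β ∈ j.toFun T, ∀ t ∈ N₁, β ∈ k.toFun t ↔ β ∈ j.toFun t) ∧
        ∀ t ∈ T, k.toFun t = j.toFun t := by
  have hI := isIndexSystem_card_le hM j hc
  have hext := j.ultClass_ext hM hne hN hI
  refine ⟨_, transClass_mos, j.ultEmb hM hne hN hI, ?_, ?_⟩
  · rintro _ ⟨h, hh, rfl⟩
    obtain ⟨P, σ, g, ⟨hP, _⟩, hg, hσ⟩ := id hh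
    refine ⟨zimg g P, fun z hz => ?_, (card_zimg_le _ _).trans hP, fun t _ hZ => ?_⟩
    · obtain ⟨p, hp, rfl⟩ := mem_zimg.1 hz
      exact hg p hp
    · refine (mos_mem_mos hext hh).2 ?_
      have := (j.transfer₂ hM (fun C G Z => ∀ p ∈ C, ∀ y ∈ C, p.pair y ∈ G → y ∈ Z)
          (graph P g) t).1 (by
        simp only [mem_univ, forall_const, pair_mem_graph]
        rintro p _ ⟨hp, rfl⟩
        exact hZ (mem_zimg.2 ⟨p, hp, rfl⟩))
      have hm := hM.of_pair_mem (j.mem_target hM hσ)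
      exact this _ hm.1 _ hm.2 hσ
  · intro T hT hTN hTc
    have hjT : (j.toFun T).IsTransitive := fun x hx y hy =>
      (j.transfer₁ hM (fun _ T => ∀ x ∈ T, ∀ y ∈ x, y ∈ T) T).1
        (fun x hx y hy => hT x hx hy) x hx y hy
    have hsub : ∀ β ∈ j.toFun T, β ∈ UltClass N₁ j.toFun
        fun P σ => P.card ≤ c ∧ σ ∈ j.toFun P := fun β hβ =>
      ⟨T, β, id, ⟨hTc, hβ⟩, hTN, j.pair_mem_graph_id hM hβ⟩
    have hself := mos_eq_self hjT hsub
    refine ⟨fun β hβ t _ => ?_, fun t ht =>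
      hself _ ((j.map_mem_iff (mem_univ _) (mem_univ _)).2 ht)⟩
    have := mos_mem_mos (y := j.toFun t) hext (hsub β hβ)
    rwa [hself β hβ] at this

/-- Composition of elementary embeddings. -/
def ElemEmb.comp {W M N : Set ZFSet.{u}} (k : ElemEmb M N) (i : ElemEmb W M) : ElemEmb W N where
  toFun x := k.toFun (i.toFun x)
  maps x hx := k.maps _ (i.maps x hx)
  elem φ v hv := (i.elem φ v hv).trans (k.elem φ _ fun l => i.maps _ (hv l))

theorem ElemEmb.map_isTransitive {M : Set ZFSet.{u}} (hM : TransClass M)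
    (j : ElemEmb (Set.univ : Set ZFSet.{u}) M) {T : ZFSet.{u}} (hT : T.IsTransitive) :
    (j.toFun T).IsTransitive := fun x hx y hy =>
  (j.transfer₁ hM (fun _ T => ∀ x ∈ T, ∀ y ∈ x, y ∈ T) T).1 (fun x hx _ hy => hT x hx hy) x hx y hy

theorem oLe.subset {κ lam : ZFSet.{u}} (hl : lam.IsTransitive) (h : oLe κ lam) : κ ⊆ lam := by
  rcases h with h | rfl
  · exact hl.subset_of_mem h
  · exact fun _ => id

/-- Combining a covering embedding with an embedding that agrees on `A`. -/
theorem lamSCFor_of_lamSC {κ lam A : ZFSet.{u}} (hl : IsOrd lam) (hκl : oLe κ lam)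
    (hsc : LamSC κ lam) {M : Set ZFSet.{u}} (hM : TransClass M)
    (j : ElemEmb (Set.univ : Set ZFSet.{u}) M) (hj : IsCrit j κ) (hlj : lam ∈ j.toFun κ)
    (hA : AgreeMem lam A (j.toFun A)) : LamSCFor κ lam A := by
  obtain ⟨N₀, -, hN₀, i₀, hi₀, -, hW⟩ := hsc
  obtain ⟨N₁, hN₁, i, hfix, hcov⟩ := exists_covers_of_wCovers hN₀ i₀ hj.1.1 hi₀.2.2 hW
  have hκc : κ.card ≤ lam.card := ZFSet.card_mono (hκl.subset hl.1)
  have hc : ℵ₀ ≤ lam.card := (hj.aleph0_le_card hM).trans hκc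
  have hκi : κ ⊆ i.toFun κ := fun α hα => by
    rw [← hfix α hα]
    exact (i.map_mem_iff (mem_univ _) (mem_univ _)).2 hα
  obtain ⟨N, hN, k, hk₁, hk₂⟩ := exists_lift hM j hN₁ ⟨_, i.map_mem_target ∅⟩ hc
  obtain ⟨hk₂, hk₃⟩ := hk₂ κ hj.1.1 (fun x hx => i.mem_target hN₁ (hκi hx)) hκc
  have hlk : lam ∈ k.toFun (i.toFun κ) :=
    (hk₂ _ hlj _ (i.map_mem_target κ)).2 (j.map_subset hM hκi hlj)
  refine ⟨N, subset_univ _, hN, k.comp i, ⟨hj.1, fun h => ?_, fun α hα => ?_⟩, hlk, ?_, ?_⟩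
  · change k.toFun (i.toFun κ) = κ at h
    rw [h] at hlk
    rcases hκl with h' | rfl
    · exact ZFSet.mem_asymm h' hlk
    · exact ZFSet.mem_irrefl _ hlk
  · change k.toFun (i.toFun α) = α
    rw [hfix α hα, hk₃ α hα, hj.2.2 α hα]
  · intro X _ hX hXl
    have : ∀ x, ∃ Z : ZFSet.{u}, x ∈ X → (∀ z ∈ Z, z ∈ N₁) ∧ Z.card ≤ lam.card ∧
        ∀ t ∈ N₁, Z ⊆ t → x ∈ k.toFun t := fun x => by
      by_cases hx : x ∈ X
      · obtain ⟨Z, hZ⟩ := hk₁ x (hX hx)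
        exact ⟨Z, fun _ => hZ⟩
      · exact ⟨∅, fun h => absurd h hx⟩
    choose Z hZ using this
    obtain ⟨t, ht, hZt, htc⟩ := hcov (bUnion Z X) (mem_univ _)
      (fun z hz => by
        obtain ⟨x, hx, hzx⟩ := mem_bUnion.1 hz
        exact (hZ x hx).1 z hzx)
      (setLeIn_univ.2 (card_bUnion_le (setLeIn_univ.1 hXl) (fun x hx => (hZ x hx).2.1) hc))
    refine ⟨k.toFun t, k.maps t ht, fun x hx => (hZ x hx).2.2 t ht fun z hz =>
      hZt (mem_bUnion.2 ⟨x, hx, hz⟩), ?_⟩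
    exact (k.transfer_two hN₁ hN (fun C a b => CardLtIn C a b) ht (i.map_mem_target κ)).1 htc
  · intro ξ hξ
    have hξj : ξ ∈ j.toFun κ := j.map_isTransitive hM hj.1.1 _ hlj hξ
    rw [hA ξ hξ]
    have := (j.transfer₃ hM (fun _ κ a b => ∀ x ∈ κ, x ∈ a ↔ x ∈ b) κ A (i.toFun A)).1
      (fun x hx => by
        conv_rhs => rw [← hfix x hx]
        exact (i.map_mem_iff (mem_univ _) (mem_univ _)).symm)
    exact (this ξ hξj).trans (hk₂ ξ hξj _ (i.map_mem_target A)).symm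

theorem ltSCFor_of_ltSC_of_ltStrongFor {δ κ A : ZFSet.{u}} (hδ : IsOrd δ) (hsc : LtSC κ δ)
    (hst : LtStrongFor κ δ A) : LtSCFor κ δ A := by
  intro lam hκl hl
  obtain ⟨M, -, hM, j, hj, hlj, -, hA⟩ := hst lam hκl hl
  exact lamSCFor_of_lamSC (isOrd_iff.2 ((isOrd_iff.1 hδ).mem hl)) hκl (hsc lam hκl hl) hM j hj hlj
    fun ξ hξ => hA ξ (mem_univ _) (ZFSet.rank_lt_of_mem hξ)

theorem subV_of_subset {A δ : ZFSet.{u}} (h : A ⊆ δ) : SubV A δ :=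
  fun _ hx => ZFSet.rank_lt_of_mem (h hx)

/-- The full covering property implies the weak one. -/
theorem wCovers_of_covers {M : Set ZFSet.{u}} (j : ElemEmb (Set.univ : Set ZFSet.{u}) M)
    {κ lam : ZFSet.{u}} (h : Covers M j.toFun κ lam) : WCovers M j.toFun κ lam := by
  obtain ⟨s, hs, hXs, hc⟩ := h (zimg j.toFun lam) (mem_univ _)
    (fun y hy => by
      obtain ⟨p, -, rfl⟩ := mem_zimg.1 hy
      exact j.map_mem_target p)
    (setLeIn_univ.2 (card_zimg_le _ _))
  exact ⟨s, hs, fun α hα => hXs (mem_zimg.2 ⟨α, hα, rfl⟩), hc⟩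

open scoped ZFSet

theorem oLe.mem_of_mem {κ lam T : ZFSet.{u}} (hT : T.IsTransitive) (h : oLe κ lam) (hl : lam ∈ T) :
    κ ∈ T := by
  rcases h with h | rfl
  · exact hT _ hl h
  · exact hl

theorem toZFSet_mem_of_lt_rank {κ : ZFSet.{u}} (hκ : IsOrd κ) {ρ : Ordinal.{u}} (h : ρ < κ.rank) :
    ρ.toZFSet ∈ κ :=
  (ZFSet.IsOrdinal.rank_lt_iff_mem (ZFSet.isOrdinal_toZFSet ρ) (isOrd_iff.1 hκ)).1
    (by rwa [Ordinal.rank_toZFSet])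

/-- An elementary embedding fixes every set of rank below its critical point. -/
theorem IsCrit.map_eq_of_rank_lt {M : Set ZFSet.{u}} (hM : TransClass M)
    {j : ElemEmb (Set.univ : Set ZFSet.{u}) M} {κ : ZFSet.{u}} (hj : IsCrit j κ) :
    ∀ x : ZFSet.{u}, x.rank < κ.rank → j.toFun x = x := by
  intro x
  induction h : x.rank using WellFoundedLT.induction generalizing x with
  | ind ρ ih =>
  intro hρ
  subst h
  set T := x.rank.toZFSet with hT
  have hjT : j.toFun T = T := hj.2.2 T (toZFSet_mem_of_lt_rank hj.1 hρ)
  set F := graph (V_ x.rank) fun y => y.rank.toZFSet with hF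
  have h₁ := (j.transfer₃ hM (fun _ V F T => ∀ y ∈ V, ∃ β ∈ T, y.pair β ∈ F) (V_ x.rank) F T).1
    (fun y hy => ⟨y.rank.toZFSet, by
      rw [hT, Ordinal.toZFSet_mem_toZFSet_iff]
      exact ZFSet.mem_vonNeumann.1 hy, pair_mem_graph.2 ⟨hy, rfl⟩⟩)
  have h₂ := (j.transfer₂ hM (fun C V F => ∀ y ∈ V, ∀ w ∈ y, w ∈ V ∧
      ∀ β ∈ C, ∀ γ ∈ C, y.pair γ ∈ F → w.pair β ∈ F → β ∈ γ) (V_ x.rank) F).1 (by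
    intro y hy w hw
    refine ⟨ZFSet.isTransitive_vonNeumann _ _ hy hw, ?_⟩
    simp only [hF, pair_mem_graph]
    rintro _ _ _ _ ⟨_, rfl⟩ ⟨_, rfl⟩
    exact Ordinal.toZFSet_mem_toZFSet_iff.2 (ZFSet.rank_lt_of_mem hw))
  have hmem : ∀ {a b}, ZFSet.pair a b ∈ j.toFun F → b ∈ M := fun h =>
    (hM.of_pair_mem (j.mem_target hM h)).2
  have h₃ : ∀ z : ZFSet.{u}, z ∈ j.toFun (V_ x.rank) → ∀ γ, z.pair γ ∈ j.toFun F →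
      z.rank ≤ γ.rank := by
    intro z
    induction z using ZFSet.inductionOn with
    | _ z ihz =>
    intro hz γ hγ
    refine ZFSet.rank_le_iff.2 fun w hw => ?_
    obtain ⟨hwV, hlt⟩ := h₂ z hz w hw
    obtain ⟨β, -, hβ⟩ := h₁ w hwV
    exact (ihz w hw hwV β hβ).trans_lt
      (ZFSet.rank_lt_of_mem (hlt β (hmem hβ) γ (hmem hγ) hγ hβ))
  have hxV : x ⊆ V_ x.rank := fun y hy => ZFSet.mem_vonNeumann.2 (ZFSet.rank_lt_of_mem hy)
  have hiff : ∀ z, j.toFun z ∈ j.toFun x ↔ z ∈ x := fun z =>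
    j.map_mem_iff (mem_univ _) (mem_univ _)
  ext z
  refine ⟨fun hz => ?_, fun hz => ?_⟩
  · have hzV := j.map_subset hM hxV hz
    obtain ⟨β, hβ, hzβ⟩ := h₁ z hzV
    rw [hjT] at hβ
    have hlt : z.rank < x.rank := (h₃ z hzV β hzβ).trans_lt
      ((ZFSet.rank_lt_of_mem hβ).trans_eq (Ordinal.rank_toZFSet _))
    rwa [← hiff z, ih _ hlt z rfl (hlt.trans hρ)]
  · have hlt := ZFSet.rank_lt_of_mem hz
    rwa [← hiff z, ih _ hlt z rfl (hlt.trans hρ)] at hz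

/-- Critical points are inaccessible: `|V_ρ| < κ` for all `ρ < κ`. -/
theorem IsCrit.card_vonNeumann_lt {M : Set ZFSet.{u}} (hM : TransClass M)
    {j : ElemEmb (Set.univ : Set ZFSet.{u}) M} {κ : ZFSet.{u}} (hj : IsCrit j κ)
    (hκj : κ ∈ j.toFun κ) {ρ : Ordinal.{u}} (hρ : ρ < κ.rank) : (V_ ρ).card < κ.card := by
  by_contra! hle
  obtain ⟨F, hF, hinj⟩ := exists_injOn_of_card_le hle
  have hV : j.toFun (V_ ρ) = V_ ρ := hj.map_eq_of_rank_lt hM _ (by rwa [ZFSet.rank_vonNeumann])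
  obtain ⟨v, hv, hκv⟩ := (j.transfer₃ hM (fun _ κ V G => ∀ a ∈ κ, ∃ v ∈ V, a.pair v ∈ G)
    κ (V_ ρ) (graph κ F)).1 (fun a ha => ⟨F a, hF a ha, pair_mem_graph.2 ⟨ha, rfl⟩⟩) κ hκj
  rw [hV] at hv
  have hjv : j.toFun v = v :=
    hj.map_eq_of_rank_lt hM _ ((ZFSet.mem_vonNeumann.1 hv).trans hρ)
  have h₁ := (j.transfer₃ hM (fun _ κ v G => ∃ a ∈ κ, a.pair v ∈ G) κ v (graph κ F)).2
    ⟨κ, hκj, by rwa [hjv]⟩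
  obtain ⟨a, ha, hav⟩ := h₁
  have hav' := (j.transfer₃ hM (fun _ a v G => a.pair v ∈ G) a v (graph κ F)).1 hav
  rw [hj.2.2 a ha, hjv] at hav'
  have h₂ := (j.transfer₁ hM (fun C G => ∀ a ∈ C, ∀ b ∈ C, ∀ v ∈ C,
      a.pair v ∈ G → b.pair v ∈ G → a = b) (graph κ F)).1 (by
    simp only [pair_mem_graph]
    rintro a _ b _ _ _ ⟨ha, rfl⟩ ⟨hb, h⟩
    exact (hinj b hb a ha h).symm)
  have m₁ := hM.of_pair_mem (j.mem_target hM hκv)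
  have m₂ := hM.of_pair_mem (j.mem_target hM hav')
  rw [h₂ _ m₂.1 _ m₁.1 _ m₁.2 hav' hκv] at ha
  exact ZFSet.mem_irrefl _ ha

theorem IsCardIn.card_lt_of_mem {δ α : ZFSet.{u}} (hδ : IsCard δ) (hα : α ∈ δ) :
    α.card < δ.card :=
  not_le.1 fun h => hδ.2 α hα (setLeIn_univ.2 h)

theorem IsCardIn.mem_of_card_lt {δ β : ZFSet.{u}} (hδ : IsCard δ) (hβ : IsOrd β)
    (h : β.card < δ.card) : β ∈ δ := by
  rcases ZFSet.IsOrdinal.mem_trichotomous (isOrd_iff.1 hβ) (isOrd_iff.1 hδ.1) with h' | h' | h'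
  · exact h'
  · exact absurd h (h' ▸ lt_irrefl _)
  · exact absurd h (not_lt.2 (ZFSet.card_mono (hβ.1.subset_of_mem h')))

section Consequences
variable {δ : ZFSet.{u}}

theorem aleph0_le_card_of_ltSCFor (h1 : ∀ A : ZFSet.{u}, A ⊆ δ → ∃ κ, κ ∈ δ ∧ LtSCFor κ δ A)
    (hδ : IsCard δ) : ℵ₀ ≤ δ.card := by
  obtain ⟨κ, hκ, h⟩ := h1 ∅ (by simp)
  obtain ⟨M, -, hM, j, hj, -⟩ := h κ (Or.inr rfl) hκ
  exact (hj.aleph0_le_card hM).trans (hδ.card_lt_of_mem hκ).le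

theorem IsCardIn.insert_mem (hδ : IsCard δ) (hc : ℵ₀ ≤ δ.card) {α : ZFSet.{u}} (hα : α ∈ δ) :
    insert α α ∈ δ := by
  refine hδ.mem_of_card_lt ?_ ?_
  · have hα' := (isOrd_iff.1 hδ.1).mem hα
    have : insert α α = (α.rank + 1).toZFSet := by
      rw [Ordinal.toZFSet_add_one, ZFSet.IsOrdinal.toZFSet_rank_eq hα']
    rw [this]
    exact isOrd_iff.2 (ZFSet.isOrdinal_toZFSet _)
  · exact ZFSet.card_insert_le.trans_lt
      (Cardinal.add_lt_of_lt hc (hδ.card_lt_of_mem hα) (one_lt_aleph0.trans_le hc))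

/-- Critical points of covering embeddings are unbounded in `δ`. -/
theorem exists_isCrit_above (hδ : IsCard δ)
    (h1 : ∀ A : ZFSet.{u}, A ⊆ δ → ∃ κ, κ ∈ δ ∧ LtSCFor κ δ A) {α : ZFSet.{u}} (hα : α ∈ δ) :
    ∃ κ ∈ δ, α ∈ κ ∧ ∃ M : Set ZFSet.{u}, TransClass M ∧
      ∃ j : ElemEmb (Set.univ : Set ZFSet.{u}) M, IsCrit j κ ∧ κ ∈ j.toFun κ := by
  obtain ⟨κ, hκ, h⟩ := h1 {α} (fun x hx => by rwa [ZFSet.mem_singleton.1 hx])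
  have hoδ := isOrd_iff.1 hδ.1
  have hακ : α ∈ κ := by
    by_contra hακ
    have hκα : oLe κ α := by
      rcases ZFSet.IsOrdinal.mem_trichotomous (hoδ.mem hκ) (hoδ.mem hα) with h | h | h
      exacts [Or.inl h, Or.inr h, absurd h hακ]
    obtain ⟨M, -, hM, j, hj, hlj, -, hA⟩ := h (insert α α)
      (Or.inl (by
        rcases hκα with h | rfl
        · exact ZFSet.mem_insert_of_mem _ h
        · exact ZFSet.mem_insert _ _)) (hδ.insert_mem (aleph0_le_card_of_ltSCFor h1 hδ) hα)
    have hαj := j.map_isTransitive hM hj.1.1 _ hlj (ZFSet.mem_insert α α)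
    have hα' : α ∈ j.toFun {α} := (hA α (ZFSet.mem_insert α α)).1 (by simp)
    have : α = j.toFun α := (j.transfer₂ hM (fun _ A a => ∀ x ∈ A, x = a) {α} α).1 (by simp) α hα'
    rcases hκα with h | rfl
    · rw [← j.map_mem_iff (mem_univ _) (mem_univ _), ← this] at h
      exact ZFSet.mem_asymm h hαj
    · exact hj.2.1 this.symm
  obtain ⟨M, -, hM, j, hj, hlj, -⟩ := h κ (Or.inr rfl) hκ
  exact ⟨κ, hκ, hακ, M, hM, j, hj, hlj⟩

theorem card_vonNeumann_lt_of_ltSCFor (hδ : IsCard δ)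
    (h1 : ∀ A : ZFSet.{u}, A ⊆ δ → ∃ κ, κ ∈ δ ∧ LtSCFor κ δ A) {ρ : Ordinal.{u}}
    (hρ : ρ < δ.rank) : (V_ ρ).card < δ.card := by
  obtain ⟨κ, hκ, hρκ, M, hM, j, hj, hκj⟩ :=
    exists_isCrit_above hδ h1 (toZFSet_mem_of_lt_rank hδ.1 hρ)
  refine (hj.card_vonNeumann_lt hM hκj ?_).trans (hδ.card_lt_of_mem hκ)
  simpa using ZFSet.rank_lt_of_mem hρκ

end Consequences

theorem oLe.isOrdinal {β γ : ZFSet.{u}} (hγ : γ.IsOrdinal) (h : oLe β γ) : β.IsOrdinal := by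
  rcases h with h | rfl
  · exact hγ.mem h
  · exact hγ

theorem oLe.mem_insert {β γ : ZFSet.{u}} (h : oLe β γ) : β ∈ insert γ γ :=
  ZFSet.mem_insert_iff.2 h.symm

theorem oLe_empty {γ : ZFSet.{u}} (hγ : γ.IsOrdinal) : oLe ∅ γ := by
  rcases ZFSet.IsOrdinal.mem_trichotomous ZFSet.isOrdinal_empty hγ with h | h | h
  · exact Or.inl h
  · exact Or.inr h
  · exact absurd h (ZFSet.notMem_empty _)

/-- The lexicographic order on pairs `(γ, β)` of ordinals. -/
def PairLt (γ' β' γ β : ZFSet.{u}) : Prop := γ' ∈ γ ∨ γ' = γ ∧ β' ∈ β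

/-- The lexicographic order on the pairs `(γ, β)` with `β ≤ γ` is set-like, which yields a
pairing function on the ordinals. -/
theorem exists_pairing : ∃ q : ZFSet.{u} → ZFSet.{u} → ZFSet.{u},
    (∀ γ β, γ.IsOrdinal → oLe β γ → IsOrd (q γ β)) ∧
    (∀ γ β z, γ.IsOrdinal → oLe β γ →
      (z ∈ q γ β ↔ ∃ γ' β', γ'.IsOrdinal ∧ oLe β' γ' ∧ PairLt γ' β' γ β ∧ q γ' β' = z)) ∧
    ∀ γ β γ' β', γ.IsOrdinal → oLe β γ → γ'.IsOrdinal → oLe β' γ' → q γ β = q γ' β' →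
      γ = γ' ∧ β = β' := by
  classical
  let α := {p : ZFSet.{u} × ZFSet.{u} // p.1.IsOrdinal ∧ oLe p.2 p.1}
  let r : α → α → Prop := fun p' p => PairLt p'.1.1 p'.1.2 p.1.1 p.1.2
  have hr : WellFounded r := by
    refine Subrelation.wf ?_ (InvImage.wf Subtype.val (Prod.lex ⟨_, ZFSet.mem_wf⟩ ⟨_, ZFSet.mem_wf⟩).wf)
    intro a b h
    exact Prod.lex_def.2 h
  have hs : ∀ x, Small.{u} {y // r y x} := by
    intro x
    have h2 : ∀ y, r y x → oLe y.1.1 x.1.1 := fun y h => h.imp id And.left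
    have h3 : ∀ y, r y x → y.1.2 ∈ insert x.1.1 x.1.1 := fun y h => by
      rcases y.2.2 with hy | hy
      · rcases h2 y h with hx | hx
        · exact ZFSet.mem_insert_of_mem _ (x.2.1.mem_trans hy hx)
        · exact ZFSet.mem_insert_of_mem _ (hx ▸ hy)
      · exact hy ▸ (h2 y h).mem_insert
    refine small_of_injective (β := (insert x.1.1 x.1.1 : ZFSet.{u}) × (insert x.1.1 x.1.1 : ZFSet.{u}))
      (f := fun y => (⟨y.1.1.1, (h2 y.1 y.2).mem_insert⟩, ⟨y.1.1.2, h3 y.1 y.2⟩)) ?_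
    intro y z h
    simp only [Prod.mk.injEq, Subtype.mk.injEq] at h
    exact Subtype.ext (Subtype.ext (Prod.ext h.1 h.2))
  have ht : ∀ x y z, r x y → r y z → r x z := by
    intro x y z h h'
    rcases h with h | ⟨h, hb⟩ <;> rcases h' with h' | ⟨h', hb'⟩
    · exact Or.inl (z.2.1.mem_trans h h')
    · exact Or.inl (h' ▸ h)
    · exact Or.inl (h ▸ h')
    · exact Or.inr ⟨h.trans h', (z.2.2.isOrdinal z.2.1).mem_trans hb hb'⟩
  have htri : ∀ x y, r x y ∨ x = y ∨ r y x := by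
    intro x y
    rcases ZFSet.IsOrdinal.mem_trichotomous x.2.1 y.2.1 with h | h | h
    · exact Or.inl (Or.inl h)
    · rcases ZFSet.IsOrdinal.mem_trichotomous (x.2.2.isOrdinal x.2.1)
        (y.2.2.isOrdinal y.2.1) with hb | hb | hb
      · exact Or.inl (Or.inr ⟨h, hb⟩)
      · exact Or.inr (Or.inl (Subtype.ext (Prod.ext h hb)))
      · exact Or.inr (Or.inr (Or.inr ⟨h.symm, hb⟩))
    · exact Or.inr (Or.inr (Or.inl h))
  let q : ZFSet.{u} → ZFSet.{u} → ZFSet.{u} := fun γ β =>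
    if h : γ.IsOrdinal ∧ oLe β γ then coll hr hs ⟨(γ, β), h⟩ else ∅
  have hq : ∀ γ β (h : γ.IsOrdinal ∧ oLe β γ), q γ β = coll hr hs ⟨(γ, β), h⟩ :=
    fun γ β h => dif_pos h
  refine ⟨q, fun γ β h h' => ?_, fun γ β z h h' => ?_, fun γ β γ' β' h₁ h₂ h₃ h₄ h => ?_⟩
  · rw [hq γ β ⟨h, h'⟩]
    exact coll_isOrd hr hs ht _
  · rw [hq γ β ⟨h, h'⟩, mem_coll]
    constructor
    · rintro ⟨⟨⟨γ', β'⟩, h₁, h₂⟩, h₃, rfl⟩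
      exact ⟨γ', β', h₁, h₂, h₃, hq γ' β' ⟨h₁, h₂⟩⟩
    · rintro ⟨γ', β', h₁, h₂, h₃, rfl⟩
      exact ⟨⟨⟨γ', β'⟩, h₁, h₂⟩, h₃, (hq γ' β' ⟨h₁, h₂⟩).symm⟩
  · rw [hq γ β ⟨h₁, h₂⟩, hq γ' β' ⟨h₃, h₄⟩] at h
    have := congrArg Subtype.val (coll_injective hr hs htri h)
    simpa using this

/-- The restriction of a binary relation to the pairs `(γ, β)` with `β ≤ γ < δ`. -/
noncomputable def relSet (δ : ZFSet.{u}) (R : ZFSet.{u} → ZFSet.{u} → Prop) : ZFSet.{u} :=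
  (δ.prod δ).sep fun p => ∃ γ β, p = γ.pair β ∧ oLe β γ ∧ R γ β

theorem pair_mem_relSet {δ : ZFSet.{u}} (hδ : IsOrd δ) {R : ZFSet.{u} → ZFSet.{u} → Prop} {γ β : ZFSet.{u}} :
    γ.pair β ∈ relSet δ R ↔ γ ∈ δ ∧ oLe β γ ∧ R γ β := by
  simp only [relSet, ZFSet.mem_sep, ZFSet.pair_mem_prod, ZFSet.pair_inj]
  constructor
  · rintro ⟨⟨h, -⟩, _, _, ⟨rfl, rfl⟩, h'⟩
    exact ⟨h, h'⟩
  · rintro ⟨h, h', h''⟩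
    exact ⟨⟨h, h'.mem_of_mem hδ.1 h⟩, _, _, ⟨rfl, rfl⟩, h', h''⟩

/-- Strong compactness for sets of ordinals extends to binary relations on ordinals. -/
theorem exists_ltSCFor_rel {δ : ZFSet.{u}} (hδ : IsCard δ)
    (h1 : ∀ A : ZFSet.{u}, A ⊆ δ → ∃ κ, κ ∈ δ ∧ LtSCFor κ δ A)
    (R : ZFSet.{u} → ZFSet.{u} → Prop) :
    ∃ κ ∈ δ, ∀ lam, oLe κ lam → lam ∈ δ → ∃ M : Set ZFSet.{u}, TransClass M ∧
      ∃ j : ElemEmb (Set.univ : Set ZFSet.{u}) M, IsCrit j κ ∧ lam ∈ j.toFun κ ∧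
        Covers M j.toFun κ lam ∧
        ∀ γ ∈ lam, ∀ β, oLe β γ → (γ.pair β ∈ j.toFun (relSet δ R) ↔ R γ β) := by
  obtain ⟨q, hqo, hqm, hqi⟩ := exists_pairing.{u}
  have hoδ := isOrd_iff.1 hδ.1
  have hc := aleph0_le_card_of_ltSCFor h1 hδ
  have hqδ : ∀ γ ∈ δ, ∀ β, oLe β γ → q γ β ∈ δ := by
    intro γ hγ β hβ
    have hγo := hoδ.mem hγ
    obtain ⟨f, hf⟩ := exists_fst_fun.{u}
    obtain ⟨s, hs⟩ := exists_snd_fun.{u}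
    set S : ZFSet.{u} := insert γ γ
    have hS : S.card < δ.card := hδ.card_lt_of_mem (hδ.insert_mem hc hγ)
    have hsub : q γ β ⊆ zimg (fun p => q (f p) (s p)) (S.prod S) := by
      intro z hz
      obtain ⟨γ', β', h₁, h₂, h₃, rfl⟩ := (hqm γ β z hγo hβ).1 hz
      have hle : oLe γ' γ := h₃.imp id And.left
      have hβ' : oLe β' γ := by
        rcases hle with h | rfl
        · exact Or.inl (h₂.mem_of_mem hγo.isTransitive h)
        · exact h₂
      exact mem_zimg.2 ⟨γ'.pair β', ZFSet.pair_mem_prod.2 ⟨hle.mem_insert, hβ'.mem_insert⟩,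
        by rw [hf, hs]⟩
    refine hδ.mem_of_card_lt (hqo γ β hγo hβ) ?_
    exact ((ZFSet.card_mono hsub).trans ((card_zimg_le _ _).trans (card_prod_le _ _))).trans_lt
      (mul_lt_of_lt hc hS hS)
  let A : ZFSet.{u} := δ.sep fun z => ∃ γ ∈ δ, ∃ β, oLe β γ ∧ R γ β ∧ q γ β = z
  have hA : ∀ γ ∈ δ, ∀ β, oLe β γ → (q γ β ∈ A ↔ R γ β) := by
    intro γ hγ β hβ
    simp only [A, ZFSet.mem_sep]
    constructor
    · rintro ⟨-, γ', hγ', β', hβ', h, he⟩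
      obtain ⟨rfl, rfl⟩ := hqi _ _ _ _ (hoδ.mem hγ') hβ' (hoδ.mem hγ) hβ he
      exact h
    · exact fun h => ⟨hqδ γ hγ β hβ, γ, hγ, β, hβ, h, rfl⟩
  let Q : ZFSet.{u} := (δ.prod (δ.prod δ)).sep fun t => ∃ γ β, oLe β γ ∧
    t = γ.pair (β.pair (q γ β))
  have hQ : ∀ {γ β z : ZFSet.{u}}, γ.pair (β.pair z) ∈ Q ↔ γ ∈ δ ∧ oLe β γ ∧ q γ β = z := by
    intro γ β z
    simp only [Q, ZFSet.mem_sep, ZFSet.pair_mem_prod, ZFSet.pair_inj]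
    constructor
    · rintro ⟨⟨h, -⟩, _, _, h', rfl, rfl, rfl⟩
      exact ⟨h, h', rfl⟩
    · rintro ⟨h, h', rfl⟩
      exact ⟨⟨h, h'.mem_of_mem hδ.1.1 h, hqδ γ h β h'⟩, _, _, h', rfl, rfl, rfl⟩
  obtain ⟨κ, hκ, h⟩ := h1 A fun z hz => (ZFSet.mem_sep.1 hz).1
  refine ⟨κ, hκ, fun lam hκl hl => ?_⟩
  have hlo := hoδ.mem hl
  obtain ⟨lam', hl', hll', hql⟩ : ∃ lam' ∈ δ, oLe lam lam' ∧ q lam ∅ ⊆ lam' := by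
    have := hqδ lam hl ∅ (oLe_empty hlo)
    rcases ZFSet.IsOrdinal.mem_trichotomous hlo (hoδ.mem this) with h | h | h
    · exact ⟨_, this, Or.inl h, fun _ => id⟩
    · exact ⟨_, this, Or.inr h, fun _ => id⟩
    · exact ⟨lam, hl, Or.inr rfl, hlo.isTransitive.subset_of_mem h⟩
  have hlo' := hoδ.mem hl'
  obtain ⟨M, -, hM, j, hj, hlj, hcov, hag⟩ := h lam' (by
    rcases hκl with h | rfl
    · exact Or.inl (hll'.subset hlo'.isTransitive h)
    · exact hll') hl'
  have htr := j.map_isTransitive hM hj.1.1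
  have hlamj : lam ∈ j.toFun κ := hll'.mem_of_mem htr hlj
  refine ⟨M, hM, j, hj, hlamj, fun X hX hXM hXl => hcov X hX hXM
    (setLeIn_univ.2 ((setLeIn_univ.1 hXl).trans
      (ZFSet.card_mono (hll'.subset hlo'.isTransitive)))), fun γ hγ β hβ => ?_⟩
  have t₁ := (j.transfer₂ hM (fun C δ Q => ∀ γ ∈ δ, ∀ β ∈ C, (β ∈ γ ∨ β = γ) → ∃ z ∈ C,
      γ.pair (β.pair z) ∈ Q) δ Q).1
    (fun γ hγ β _ hβ => ⟨q γ β, mem_univ _, hQ.2 ⟨hγ, hβ, rfl⟩⟩)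
  have t₂ := (j.transfer₃ hM (fun C A S Q => ∀ γ ∈ C, ∀ β ∈ C, ∀ z ∈ C,
      γ.pair (β.pair z) ∈ Q → (z ∈ A ↔ γ.pair β ∈ S)) A (relSet δ R) Q).1 (by
    intro γ _ β _ z _ hz
    obtain ⟨hγ, hβ, rfl⟩ := hQ.1 hz
    rw [hA γ hγ β hβ, pair_mem_relSet hδ.1]
    simp [hγ, hβ])
  have t₃ := (j.transfer₁ hM (fun C Q => ∀ γ ∈ C, ∀ β ∈ C, ∀ z ∈ C, γ.pair (β.pair z) ∈ Q →
      ∀ w ∈ C, (w ∈ z ↔ ∃ γ' ∈ C, ∃ β' ∈ C, (γ' ∈ γ ∨ (γ' = γ ∧ β' ∈ β)) ∧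
        γ'.pair (β'.pair w) ∈ Q)) Q).1 (by
    intro γ _ β _ z _ hz w _
    obtain ⟨hγ, hβ, rfl⟩ := hQ.1 hz
    rw [hqm γ β w (hoδ.mem hγ) hβ]
    constructor
    · rintro ⟨γ', β', h₁, h₂, h₃, rfl⟩
      have hle : oLe γ' γ := h₃.imp id And.left
      exact ⟨γ', mem_univ _, β', mem_univ _, h₃, hQ.2 ⟨hle.mem_of_mem hδ.1.1 hγ, h₂, rfl⟩⟩
    · rintro ⟨γ', _, β', _, h₃, h⟩
      obtain ⟨hγ', h₂, rfl⟩ := hQ.1 h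
      exact ⟨γ', β', hoδ.mem hγ', h₂, h₃, rfl⟩)
  have t₄ := (j.transfer₂ hM (fun C δ Q => ∀ γ ∈ C, ∀ β ∈ C, ∀ z ∈ C, γ.pair (β.pair z) ∈ Q →
      γ ∈ δ ∧ (β ∈ γ ∨ β = γ)) δ Q).1 (by
    intro γ _ β _ z _ hz
    obtain ⟨hγ, hβ, rfl⟩ := hQ.1 hz
    exact ⟨hγ, hβ⟩)
  have hmem : ∀ {γ β z}, ZFSet.pair γ (ZFSet.pair β z) ∈ j.toFun Q → γ ∈ M ∧ β ∈ M ∧ z ∈ M :=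
    fun h => ⟨(hM.of_pair_mem (j.mem_target hM h)).1,
      hM.of_pair_mem (hM.of_pair_mem (j.mem_target hM h)).2⟩
  have hjδ : (j.toFun δ).IsOrdinal := by
    refine isOrd_iff.1 ⟨j.map_isTransitive hM hδ.1.1, fun y hy z hz w hw => ?_⟩
    exact (j.transfer₁ hM (fun _ d => ∀ y ∈ d, ∀ z ∈ y, ∀ w ∈ z, w ∈ y) δ).1
      (fun y hy z hz w hw => (hoδ.mem hy).isTransitive z hz hw) y hy z hz w hw
  have key : ∀ z γ β : ZFSet.{u}, γ.pair (β.pair z) ∈ j.toFun Q → z = q γ β := by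
    intro z
    induction z using ZFSet.inductionOn with
    | _ z ih =>
    intro γ β hz
    obtain ⟨m₁, m₂, m₃⟩ := hmem hz
    obtain ⟨hγ, hβ⟩ := t₄ γ m₁ β m₂ z m₃ hz
    have hγo := hjδ.mem hγ
    ext w
    rw [hqm γ β w hγo hβ]
    constructor
    · intro hw
      obtain ⟨γ', -, β', -, hlt, h⟩ := (t₃ γ m₁ β m₂ z m₃ hz w (hM _ m₃ _ hw)).1 hw
      obtain ⟨n₁, n₂, n₃⟩ := hmem h
      obtain ⟨hγ', hβ'⟩ := t₄ _ n₁ _ n₂ _ n₃ h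
      exact ⟨γ', β', hjδ.mem hγ', hβ', hlt, (ih w hw γ' β' h).symm⟩
    · rintro ⟨γ', β', h₁, h₂, hlt, rfl⟩
      have hle : oLe γ' γ := hlt.imp id And.left
      have hγ' := hle.mem_of_mem hjδ.isTransitive hγ
      obtain ⟨w, hw, h⟩ := t₁ γ' hγ' β'
        (j.mem_target hM (h₂.mem_of_mem hjδ.isTransitive hγ')) h₂
      obtain ⟨n₁, n₂, n₃⟩ := hmem h
      have hwz := (t₃ γ m₁ β m₂ z m₃ hz w n₃).2 ⟨γ', n₁, β', n₂, hlt, h⟩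
      rwa [← ih w hwz γ' β' h]
  have hγj : γ ∈ j.toFun δ :=
    j.map_subset hM (hδ.1.1.subset_of_mem hκ) (htr _ hlamj hγ)
  have hγδ : γ ∈ δ := hδ.1.1 _ hl hγ
  obtain ⟨z, -, hz⟩ := t₁ γ hγj β (j.mem_target hM (hβ.mem_of_mem hjδ.isTransitive hγj)) hβ
  obtain ⟨m₁, m₂, m₃⟩ := hmem hz
  rw [← t₂ γ m₁ β m₂ z m₃ hz, key z γ β hz, ← hA γ hγδ β hβ]
  refine (hag _ (hql ?_)).symm
  exact (hqm lam ∅ _ hlo (oLe_empty hlo)).2 ⟨γ, β, hlo.mem hγ, hβ, Or.inl hγ, rfl⟩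

theorem exists_ltSCFor2 {δ : ZFSet.{u}} (hδ : IsCard δ)
    (h1 : ∀ A : ZFSet.{u}, A ⊆ δ → ∃ κ, κ ∈ δ ∧ LtSCFor κ δ A) {A₁ A₂ : ZFSet.{u}}
    (hA₁ : A₁ ⊆ δ) (hA₂ : A₂ ⊆ δ) : ∃ κ, κ ∈ δ ∧ LtSCFor2 κ δ A₁ A₂ := by
  let R : ZFSet.{u} → ZFSet.{u} → Prop := fun γ β =>
    (β = γ ∧ γ ∈ A₁) ∨ (β = ∅ ∧ γ ≠ ∅ ∧ γ ∈ A₂)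
  have hR₁ : ∀ γ, R γ γ ↔ γ ∈ A₁ := fun γ => by
    simp only [R, true_and, or_iff_left_iff_imp]
    exact fun h => absurd h.1 h.2.1
  have hR₂ : ∀ γ, γ ≠ ∅ → (R γ ∅ ↔ γ ∈ A₂) := fun γ h => by
    simp [R, h, h.symm]
  have hoδ := isOrd_iff.1 hδ.1
  obtain ⟨κ, hκ, h⟩ := exists_ltSCFor_rel hδ h1 R
  refine ⟨κ, hκ, fun lam hκl hl => ?_⟩
  obtain ⟨M, hM, j, hj, hlj, hcov, hag⟩ := h lam hκl hl
  have hlo := hoδ.mem hl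
  have hmem : ∀ ξ ∈ lam, ξ ∈ M := fun ξ hξ =>
    j.mem_target hM (j.map_isTransitive hM hj.1.1 _ hlj hξ)
  refine ⟨M, hM, j, hj, hlj, hcov, fun ξ hξ => ?_, fun ξ hξ => ?_⟩
  · have t := (j.transfer₂ hM (fun C A S => ∀ ξ ∈ C, (ξ ∈ A ↔ ξ.pair ξ ∈ S)) A₁ (relSet δ R)).1
      (fun ξ _ => by
        rw [pair_mem_relSet hδ.1, hR₁]
        exact ⟨fun h => ⟨hA₁ h, Or.inr rfl, h⟩, fun h => h.2.2⟩)
    rw [t ξ (hmem ξ hξ), hag ξ hξ ξ (Or.inr rfl), hR₁]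
  · have hje := j.map_empty hM
    by_cases h0 : ξ = ∅
    · rw [h0]
      conv_rhs => rw [← hje]
      exact (j.map_mem_iff (mem_univ _) (mem_univ _)).symm
    · have t := (j.transfer₃ hM (fun C A S e => ∀ ξ ∈ C, ¬ ξ = e → (ξ ∈ A ↔ ξ.pair e ∈ S))
          A₂ (relSet δ R) ∅).1 (fun ξ _ hne => by
        rw [pair_mem_relSet hδ.1, hR₂ ξ hne]
        exact ⟨fun h => ⟨hA₂ h, oLe_empty (hoδ.mem (hA₂ h)), h⟩, fun h => h.2.2⟩)
      rw [hje] at t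
      rw [t ξ (hmem ξ hξ) h0, hag ξ hξ ∅ (oLe_empty (hlo.mem hξ)), hR₂ ξ h0]

/-- An enumeration of the universe by ordinals, in order of increasing rank. -/
theorem exists_enum : ∃ pos e : ZFSet.{u} → ZFSet.{u}, (∀ x, IsOrd (pos x)) ∧
    (∀ x, e (pos x) = x) ∧ (∀ γ, ∀ z ∈ e γ, ∃ β ∈ γ, e β = z) ∧
    (∀ x y, x.rank < y.rank → pos x ∈ pos y) ∧
    ∀ x, ∀ z ∈ pos x, ∃ y, y.rank ≤ x.rank ∧ pos y = z := by
  classical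
  let r : ZFSet.{u} → ZFSet.{u} → Prop := fun x y =>
    x.rank < y.rank ∨ x.rank = y.rank ∧ WellOrderingRel x y
  have hr : WellFounded r := by
    refine Subrelation.wf ?_ (InvImage.wf (fun x : ZFSet.{u} => (x.rank, x))
      (Prod.lex ⟨_, wellFounded_lt⟩ ⟨_, WellOrderingRel.isWellOrder.wf⟩).wf)
    intro a b h
    exact Prod.lex_def.2 h
  have hle : ∀ x y, r x y → x.rank ≤ y.rank := fun x y h => h.elim le_of_lt fun h => h.1.le
  have hs : ∀ x, Small.{u} {y // r y x} := fun x =>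
    small_of_forall_mem (V_ (x.rank + 1)) fun y h =>
      ZFSet.mem_vonNeumann.2 (Order.lt_add_one_iff.2 (hle y x h))
  have ht : ∀ x y z, r x y → r y z → r x z := by
    intro x y z h h'
    rcases h with h | ⟨h, hb⟩ <;> rcases h' with h' | ⟨h', hb'⟩
    · exact Or.inl (h.trans h')
    · exact Or.inl (h' ▸ h)
    · exact Or.inl (h ▸ h')
    · exact Or.inr ⟨h.trans h', _root_.trans hb hb'⟩
  have htri : ∀ x y, r x y ∨ x = y ∨ r y x := by
    intro x y
    rcases lt_trichotomy x.rank y.rank with h | h | h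
    · exact Or.inl (Or.inl h)
    · rcases trichotomous_of WellOrderingRel x y with hb | hb | hb
      · exact Or.inl (Or.inr ⟨h, hb⟩)
      · exact Or.inr (Or.inl hb)
      · exact Or.inr (Or.inr (Or.inr ⟨h.symm, hb⟩))
    · exact Or.inr (Or.inr (Or.inl h))
  let pos := coll hr hs
  have hinj : Function.Injective pos := coll_injective hr hs htri
  have hlt : ∀ x y, x.rank < y.rank → pos x ∈ pos y := fun x y h =>
    (mem_coll hr hs).2 ⟨x, Or.inl h, rfl⟩
  let e : ZFSet.{u} → ZFSet.{u} := fun γ => if h : ∃ x, pos x = γ then h.choose else ∅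
  have he : ∀ x, e (pos x) = x := fun x => by
    have h : ∃ y, pos y = pos x := ⟨x, rfl⟩
    simp only [e, dif_pos h]
    exact hinj h.choose_spec
  refine ⟨pos, e, coll_isOrd hr hs ht, he, fun γ z hz => ?_, hlt, fun x z hz => ?_⟩
  · by_cases h : ∃ x, pos x = γ
    · obtain ⟨x, rfl⟩ := h
      rw [he] at hz
      exact ⟨pos z, hlt _ _ (ZFSet.rank_lt_of_mem hz), he z⟩
    · simp [e, dif_neg h] at hz
  · obtain ⟨y, hy, rfl⟩ := (mem_coll hr hs).1 hz
    exact ⟨y, hle _ _ hy, rfl⟩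

theorem exists_ltSC_and_ltStrongFor {δ : ZFSet.{u}} (hδ : IsCard δ)
    (h1 : ∀ A : ZFSet.{u}, A ⊆ δ → ∃ κ, κ ∈ δ ∧ LtSCFor κ δ A) (A : ZFSet.{u})  :
    ∃ κ, κ ∈ δ ∧ LtSC κ δ ∧ LtStrongFor κ δ A := by
  obtain ⟨pos, e, hpo, he, hem, hlt, hpm⟩ := exists_enum.{u}
  have hoδ := isOrd_iff.1 hδ.1
  have hc := aleph0_le_card_of_ltSCFor h1 hδ
  let R : ZFSet.{u} → ZFSet.{u} → Prop := fun γ β => (β = γ ∧ e γ ∈ A) ∨ (β ∈ γ ∧ e β ∈ e γ)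
  have hR₁ : ∀ γ, R γ γ ↔ e γ ∈ A := fun γ => by simp [R, ZFSet.mem_irrefl]
  have hR₂ : ∀ γ, ∀ β ∈ γ, (R γ β ↔ e β ∈ e γ) := fun γ β h => by
    have : β ≠ γ := fun h' => ZFSet.mem_irrefl _ (h' ▸ h)
    simp [R, h, this]
  obtain ⟨κ, hκ, h⟩ := exists_ltSCFor_rel hδ h1 R
  refine ⟨κ, hκ, fun lam hκl hl => ?_, fun lam hκl hl => ?_⟩
  · obtain ⟨M, hM, j, hj, hlj, hcov, -⟩ := h lam hκl hl
    exact ⟨M, subset_univ _, hM, j, hj, hlj, wCovers_of_covers j hcov⟩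
  have hlo := hoδ.mem hl
  have hpδ : pos (V_ lam.rank) ∈ δ := by
    refine hδ.mem_of_card_lt (hpo _) ?_
    have hsub : pos (V_ lam.rank) ⊆ zimg pos (V_ (lam.rank + 1)) := fun z hz => by
      obtain ⟨y, hy, rfl⟩ := hpm _ z hz
      rw [ZFSet.rank_vonNeumann] at hy
      exact mem_zimg.2 ⟨y, ZFSet.mem_vonNeumann.2 (Order.lt_add_one_iff.2 hy), rfl⟩
    refine ((ZFSet.card_mono hsub).trans (card_zimg_le _ _)).trans_lt
      (card_vonNeumann_lt_of_ltSCFor hδ h1 ?_)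
    have := ZFSet.rank_lt_of_mem (hδ.insert_mem hc hl)
    rw [ZFSet.rank_insert] at this
    exact (le_max_left _ _).trans_lt this
  obtain ⟨lam', hl', hll', hpl⟩ : ∃ lam' ∈ δ, oLe lam lam' ∧ pos (V_ lam.rank) ⊆ lam' := by
    rcases ZFSet.IsOrdinal.mem_trichotomous hlo (hoδ.mem hpδ) with h | h | h
    · exact ⟨_, hpδ, Or.inl h, fun _ => id⟩
    · exact ⟨_, hpδ, Or.inr h, fun _ => id⟩
    · exact ⟨lam, hl, Or.inr rfl, hlo.isTransitive.subset_of_mem h⟩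
  have hlo' := hoδ.mem hl'
  obtain ⟨M, hM, j, hj, hlj, -, hag⟩ := h lam' (by
    rcases hκl with h | rfl
    · exact Or.inl (hll'.subset hlo'.isTransitive h)
    · exact hll') hl'
  have htr := j.map_isTransitive hM hj.1.1
  set S := relSet δ R
  set E := graph δ e
  have t₁ := (j.transfer₂ hM (fun C δ E => ∀ γ ∈ δ, ∃ x ∈ C, γ.pair x ∈ E) δ E).1
    (fun γ hγ => ⟨e γ, mem_univ _, pair_mem_graph.2 ⟨hγ, rfl⟩⟩)
  have t₂ := (j.transfer₂ hM (fun C S E => ∀ γ ∈ C, ∀ x ∈ C, ∀ β ∈ C, ∀ y ∈ C, γ.pair x ∈ E →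
      β.pair y ∈ E → β ∈ γ → (y ∈ x ↔ γ.pair β ∈ S)) S E).1 (by
    simp only [E, S, pair_mem_graph, pair_mem_relSet hδ.1]
    rintro γ _ _ _ β _ _ _ ⟨hγ, rfl⟩ ⟨hβ, rfl⟩ hβγ
    rw [hR₂ γ β hβγ]
    exact ⟨fun h => ⟨hγ, Or.inl hβγ, h⟩, fun h => h.2.2⟩)
  have t₃ := (j.transfer₁ hM (fun C E => ∀ γ ∈ C, ∀ x ∈ C, γ.pair x ∈ E → ∀ z ∈ x, ∃ β ∈ γ,
      β.pair z ∈ E) E).1 (by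
    simp only [E, pair_mem_graph]
    rintro γ _ _ _ ⟨hγ, rfl⟩ z hz
    obtain ⟨β, hβ, rfl⟩ := hem γ z hz
    exact ⟨β, hβ, hδ.1.1 _ hγ hβ, rfl⟩)
  have t₄ := (j.transfer₃ hM (fun C S E A => ∀ γ ∈ C, ∀ x ∈ C, γ.pair x ∈ E →
      (x ∈ A ↔ γ.pair γ ∈ S)) S E A).1 (by
    simp only [E, S, pair_mem_graph, pair_mem_relSet hδ.1]
    rintro γ _ _ _ ⟨hγ, rfl⟩
    rw [hR₁]
    exact ⟨fun h => ⟨hγ, Or.inr rfl, h⟩, fun h => h.2.2⟩)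
  have hmem : ∀ {a b}, ZFSet.pair a b ∈ j.toFun E → a ∈ M ∧ b ∈ M := fun h =>
    hM.of_pair_mem (j.mem_target hM h)
  have hlδ : ∀ γ ∈ lam', γ ∈ j.toFun δ := fun γ hγ =>
    j.map_subset hM (hδ.1.1.subset_of_mem hκ) (htr _ hlj hγ)
  have key : ∀ γ : ZFSet.{u}, γ ∈ lam' → ∀ x, γ.pair x ∈ j.toFun E → x = e γ := by
    intro γ
    induction γ using ZFSet.inductionOn with
    | _ γ ih =>
    intro hγ x hx
    obtain ⟨m₁, m₂⟩ := hmem hx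
    ext z
    constructor
    · intro hz
      obtain ⟨β, hβ, hβz⟩ := t₃ γ m₁ x m₂ hx z hz
      have := (t₂ γ m₁ x m₂ β (hmem hβz).1 z (hmem hβz).2 hx hβz hβ).1 hz
      rw [hag γ hγ β (Or.inl hβ), hR₂ γ β hβ] at this
      rwa [ih β hβ (hlo'.mem_trans hβ hγ) z hβz]
    · intro hz
      obtain ⟨β, hβ, rfl⟩ := hem γ z hz
      have hβl := hlo'.mem_trans hβ hγ
      obtain ⟨y, hy, hβy⟩ := t₁ β (hlδ β hβl)
      rw [← ih β hβ hβl y hβy, t₂ γ m₁ x m₂ β (hmem hβy).1 y hy hx hβy hβ,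
        hag γ hγ β (Or.inl hβ), hR₂ γ β hβ]
      exact hz
  have hmain : ∀ x : ZFSet.{u}, VMem lam x → (pos x).pair x ∈ j.toFun E ∧ pos x ∈ lam' := by
    intro x hx
    have hpx : pos x ∈ lam' := hpl (hlt x _ (by rwa [ZFSet.rank_vonNeumann]))
    obtain ⟨y, -, hy⟩ := t₁ _ (hlδ _ hpx)
    have := key _ hpx y hy
    rw [he] at this
    exact ⟨this ▸ hy, hpx⟩
  refine ⟨M, subset_univ _, hM, j, hj, hll'.mem_of_mem htr hlj, fun x _ hx => ?_, fun x _ hx => ?_⟩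
  · exact (hmem (hmain x hx).1).2
  · obtain ⟨h₁, h₂⟩ := hmain x hx
    rw [t₄ _ (hmem h₁).1 x (hmem h₁).2 h₁, hag _ h₂ _ (Or.inr rfl), hR₁, he]

end Helpers

/-- **Proposition (second-order characterisations).**  For a cardinal `δ` the
following are equivalent: (1) for every `A ⊆ δ` there is `κ < δ` which is
`<δ`-strongly compact for `A`; (2) for all `A₁, A₂ ⊆ δ` there is `κ < δ` which
is `<δ`-strongly compact for `A₁ ⊕ A₂`; (3) for every `A ⊆ V_δ` there is
`κ < δ` which is both `<δ`-strongly compact and `<δ`-strong for `A`. -/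
theorem wsc_second_order (δ : ZFSet) (hδ : IsCard δ) :
    ((∀ A : ZFSet, A ⊆ δ → ∃ κ, κ ∈ δ ∧ LtSCFor κ δ A) ↔
      (∀ A₁ A₂ : ZFSet, A₁ ⊆ δ → A₂ ⊆ δ → ∃ κ, κ ∈ δ ∧ LtSCFor2 κ δ A₁ A₂)) ∧
    ((∀ A : ZFSet, A ⊆ δ → ∃ κ, κ ∈ δ ∧ LtSCFor κ δ A) ↔
      (∀ A : ZFSet, SubV A δ → ∃ κ, κ ∈ δ ∧ LtSC κ δ ∧ LtStrongFor κ δ A)) := by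
  refine ⟨⟨fun h1 A₁ A₂ hA₁ hA₂ => exists_ltSCFor2 hδ h1 hA₁ hA₂, fun h2 A hA => ?_⟩,
    fun h1 A _ => exists_ltSC_and_ltStrongFor hδ h1 A, fun h3 A hA => ?_⟩
  · obtain ⟨κ, hκ, h⟩ := h2 A A hA hA
    refine ⟨κ, hκ, fun lam hκl hl => ?_⟩
    obtain ⟨M, hM, j, hj, hlj, hcov, hag, -⟩ := h lam hκl hl
    exact ⟨M, Set.subset_univ _, hM, j, hj, hlj, hcov, hag⟩
  · obtain ⟨κ, hκ, hsc, hst⟩ := h3 A (subV_of_subset hA)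
    exact ⟨κ, hκ, ltSCFor_of_ltSC_of_ltStrongFor hδ.1 hsc hst⟩

end WSC
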